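/- arXiv:1605.01172 — 3 statements merged into one kernel-verified Lean document; each statement's English description precedes it below -/
import Mathlib

section
/- For every integer k ≥ 1 and every real c with 0 < c < 1, if ε = c/k² then F_2(ε, 2^k + 1) > (c/24)·ε; that is, there exists a full ε-approximate Steiner tree T on 2^k + 1 terminals in ℝ² such that L(T) > (1 + (c/24)ε)·L(S(T)). -/
open Real

noncomputable section


/-- Vertex set of a full Steiner topology on `n` terminals:
`n` terminals and `n - 2` Steiner points. -/
abbrev SteinerVert (n : ℕ) := Fin n ⊕ Fin (n - 2)

/-- Euclidean space `ℝ^d`. -/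
abbrev Epc (d : ℕ) := EuclideanSpace ℝ (Fin d)

/-- A full Steiner topology on `n` terminals: a tree on `n` terminals and `n - 2`
Steiner points in which every terminal has degree `1` and every Steiner point has
degree `3`. -/
structure FullSteinerTopology (n : ℕ) where
  graph : SimpleGraph (SteinerVert n)
  isTree : graph.IsTree
  degTerminal : ∀ t : Fin n, (graph.neighborSet (Sum.inl t)).ncard = 1
  degSteiner : ∀ s : Fin (n - 2), (graph.neighborSet (Sum.inr s)).ncard = 3

open Classical in
/-- The total length of the Steiner tree obtained by realizing the topology `G`
via the placement `pos`, i.e. the sum of the Euclidean lengths of its edges. -/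
noncomputable def treeLength {n d : ℕ} (G : FullSteinerTopology n)
    (pos : SteinerVert n → Epc d) : ℝ :=
  (1 / 2) * ∑ u : SteinerVert n, ∑ v : SteinerVert n,
    if G.graph.Adj u v then dist (pos u) (pos v) else 0

/-- The realization `pos` of the topology `G` is a full `ε`-approximate Steiner tree:
at every Steiner point, every angle spanned by two incident edges lies in
`[2π/3 - ε, 2π/3 + ε]`. -/
def IsApproxSteiner {n d : ℕ} (ε : ℝ) (G : FullSteinerTopology n)
    (pos : SteinerVert n → Epc d) : Prop :=
  ∀ s : Fin (n - 2), ∀ u v : SteinerVert n,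
    G.graph.Adj (Sum.inr s) u → G.graph.Adj (Sum.inr s) v → u ≠ v →
      |EuclideanGeometry.angle (pos u) (pos (Sum.inr s)) (pos v) - 2 * π / 3| ≤ ε

/-- A locally minimum Steiner tree: no degenerate edges, and every angle spanned by
two edges at a common vertex is at least `2π/3`. -/
def IsLocallyMinimumTree {n d : ℕ} (G : FullSteinerTopology n)
    (pos : SteinerVert n → Epc d) : Prop :=
  (∀ u v : SteinerVert n, G.graph.Adj u v → pos u ≠ pos v) ∧
  ∀ x u v : SteinerVert n, G.graph.Adj x u → G.graph.Adj x v → u ≠ v →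
    2 * π / 3 ≤ EuclideanGeometry.angle (pos u) (pos x) (pos v)

/-- The length `L(S(T))` of the shortest Steiner tree with the same topology `G` and the
same terminals as the realization `pos` (degenerate edges allowed). -/
noncomputable def minTreeLength {n d : ℕ} (G : FullSteinerTopology n)
    (pos : SteinerVert n → Epc d) : ℝ :=
  sInf { L : ℝ | ∃ pos' : SteinerVert n → Epc d,
    (∀ t : Fin n, pos' (Sum.inl t) = pos (Sum.inl t)) ∧ L = treeLength G pos' }

/-- `F_d(ε, n)`: the supremum of `L(T)/L(S(T)) - 1` over all full `ε`-approximate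
Steiner trees `T` on `n` terminals in `ℝ^d`. -/
noncomputable def steinerF (d : ℕ) (ε : ℝ) (n : ℕ) : ℝ :=
  sSup { r : ℝ | ∃ (G : FullSteinerTopology n) (pos : SteinerVert n → Epc d),
    IsApproxSteiner ε G pos ∧
    r = treeLength G pos / minTreeLength G pos - 1 }

/-- `G_d(ε, n)`: the supremum of `L(T)/L(S(T)) - 1` over all full `ε`-approximate
Steiner trees `T` on `n` terminals in `ℝ^d` such that the shortest tree `S(T)` with the
same terminals and topology is a (non-degenerate) locally minimum Steiner tree. -/
noncomputable def steinerG (d : ℕ) (ε : ℝ) (n : ℕ) : ℝ :=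
  sSup { r : ℝ | ∃ (G : FullSteinerTopology n)
    (pos pos' : SteinerVert n → Epc d),
    IsApproxSteiner ε G pos ∧
    (∀ t : Fin n, pos' (Sum.inl t) = pos (Sum.inl t)) ∧
    treeLength G pos' = minTreeLength G pos ∧
    IsLocallyMinimumTree G pos' ∧
    r = treeLength G pos / minTreeLength G pos - 1 }



/-- The graph on `{0, …, N - 1}` joining every nonzero `a` to `a / 2`. -/
def halvingGraph (N : ℕ) : SimpleGraph (Fin N) where
  Adj a b := (a.val ≠ 0 ∧ b.val = a.val / 2) ∨ (b.val ≠ 0 ∧ a.val = b.val / 2)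
  symm := ⟨fun _ _ h => h.symm⟩
  loopless := ⟨fun a h => by omega⟩

lemma halvingGraph_connected {N : ℕ} (hN : 0 < N) : (halvingGraph N).Connected := by
  have hreach : ∀ j : ℕ, ∀ hj : j < N, (halvingGraph N).Reachable ⟨j, hj⟩ ⟨0, hN⟩ := by
    intro j
    induction j using Nat.strong_induction_on with
    | _ j ih =>
      intro hj
      rcases Nat.eq_zero_or_pos j with rfl | hpos
      · exact SimpleGraph.Reachable.refl _
      · have hadj : (halvingGraph N).Adj ⟨j, hj⟩ ⟨j / 2, by omega⟩ :=
          Or.inl ⟨by simpa using hpos.ne', rfl⟩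
        exact hadj.reachable.trans (ih (j / 2) (by omega) _)
  have : Nonempty (Fin N) := ⟨⟨0, hN⟩⟩
  exact ⟨fun a b => (hreach a a.2).trans (hreach b b.2).symm⟩

open Classical in
lemma sum_halvingGraph_adj {N : ℕ} (f : ℕ → ℕ → ℝ) (hf : ∀ a b, f a b = f b a) :
    ∑ a : Fin N, ∑ b : Fin N, (if (halvingGraph N).Adj a b then f a b else 0)
      = 2 * ∑ j ∈ Finset.Ico 1 N, f j (j / 2) := by
  have hsplit : ∀ a b : Fin N, (if (halvingGraph N).Adj a b then f a b else 0)
      = (if a.val ≠ 0 ∧ b.val = a.val / 2 then f a b else 0)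
        + (if b.val ≠ 0 ∧ a.val = b.val / 2 then f b a else 0) := by
    intro a b
    by_cases h1 : a.val ≠ 0 ∧ b.val = a.val / 2
    · have h2 : ¬ (b.val ≠ 0 ∧ a.val = b.val / 2) := by omega
      rw [if_pos (show (halvingGraph N).Adj a b from Or.inl h1), if_pos h1, if_neg h2, add_zero]
    · by_cases h2 : b.val ≠ 0 ∧ a.val = b.val / 2
      · rw [if_pos (show (halvingGraph N).Adj a b from Or.inr h2), if_neg h1, if_pos h2, zero_add,
          hf]
      · rw [if_neg (show ¬ (halvingGraph N).Adj a b from not_or.2 ⟨h1, h2⟩), if_neg h1, if_neg h2,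
          add_zero]
  have hparent : ∑ a : Fin N, ∑ b : Fin N,
      (if a.val ≠ 0 ∧ b.val = a.val / 2 then f a b else 0)
        = ∑ j ∈ Finset.Ico 1 N, f j (j / 2) := by
    have hrow : ∀ a : Fin N, ∑ b : Fin N,
        (if a.val ≠ 0 ∧ b.val = a.val / 2 then f a b else 0)
          = if a.val ≠ 0 then f a (a.val / 2) else 0 := by
      intro a
      rw [Finset.sum_eq_single (⟨a.val / 2, by omega⟩ : Fin N)]
      · simp
      · intro b _ hb
        rw [if_neg]
        rintro ⟨-, h⟩
        exact hb (Fin.ext h)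
      · simp
    rw [Finset.sum_congr rfl fun a _ => hrow a,
      Fin.sum_univ_eq_sum_range (fun j => if j ≠ 0 then f j (j / 2) else 0) N,
      ← Finset.sum_filter]
    congr 1
    ext j
    simp only [Finset.mem_filter, Finset.mem_range, Finset.mem_Ico]
    omega
  simp_rw [hsplit, Finset.sum_add_distrib]
  rw [hparent, Finset.sum_comm, hparent]
  ring

lemma halvingGraph_isTree {N : ℕ} (hN : 0 < N) : (halvingGraph N).IsTree := by
  classical
  rw [SimpleGraph.isTree_iff_connected_and_card]
  refine ⟨halvingGraph_connected hN, ?_⟩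
  have hsum := sum_halvingGraph_adj (N := N) (fun _ _ => 1) (fun _ _ => rfl)
  have hdeg := (halvingGraph N).sum_degrees_eq_twice_card_edges
  have hcast : ((∑ a, (halvingGraph N).degree a : ℕ) : ℝ)
      = ∑ a : Fin N, ∑ b : Fin N, (if (halvingGraph N).Adj a b then (1 : ℝ) else 0) := by
    push_cast
    refine Finset.sum_congr rfl fun a _ => ?_
    rw [Finset.sum_boole, ← SimpleGraph.card_neighborFinset_eq_degree,
      SimpleGraph.neighborFinset_eq_filter]
  rw [hdeg, hsum] at hcast
  have hcard : 2 * (halvingGraph N).edgeFinset.card = 2 * (N - 1) := by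
    have : ((2 * (halvingGraph N).edgeFinset.card : ℕ) : ℝ) = ((2 * (N - 1) : ℕ) : ℝ) := by
      rw [hcast]
      simp
    exact_mod_cast this
  rw [Nat.card_eq_fintype_card, ← SimpleGraph.edgeFinset_card, Nat.card_eq_fintype_card,
    Fintype.card_fin]
  omega

lemma ncard_neighborSet_halvingGraph_leaf {M : ℕ} (h1 : 1 < 2 * M) (a : Fin (2 * M))
    (ha : a.val = 0 ∨ M ≤ a.val) :
    ((halvingGraph (2 * M)).neighborSet a).ncard = 1 := by
  rw [Set.ncard_eq_one]
  rcases ha with ha | ha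
  · refine ⟨⟨1, h1⟩, Set.ext fun b => ?_⟩
    simp only [SimpleGraph.mem_neighborSet, Set.mem_singleton_iff, Fin.ext_iff, halvingGraph]
    omega
  · refine ⟨⟨a.val / 2, by omega⟩, Set.ext fun b => ?_⟩
    simp only [SimpleGraph.mem_neighborSet, Set.mem_singleton_iff, Fin.ext_iff, halvingGraph]
    omega

lemma ncard_neighborSet_halvingGraph_inner {M : ℕ} (a : Fin (2 * M))
    (ha : 1 ≤ a.val) (haM : a.val < M) :
    ((halvingGraph (2 * M)).neighborSet a).ncard = 3 := by
  rw [Set.ncard_eq_three]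
  refine ⟨⟨a.val / 2, by omega⟩, ⟨2 * a.val, by omega⟩, ⟨2 * a.val + 1, by omega⟩,
    ?_, ?_, ?_, Set.ext fun b => ?_⟩
  · simp only [ne_eq, Fin.ext_iff]; omega
  · simp only [ne_eq, Fin.ext_iff]; omega
  · simp only [ne_eq, Fin.ext_iff]; omega
  · simp only [SimpleGraph.mem_neighborSet, Set.mem_insert_iff, Set.mem_singleton_iff,
      Fin.ext_iff, halvingGraph]
    omega

/-- The terminals become the root `0` and the leaves `M, …, 2 * M - 1`, and the Steiner points
become the inner nodes `1, …, M - 1`. -/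
lemma exists_labelling (M : ℕ) (hM : 1 ≤ M) :
    ∃ e : (Fin (M + 1) ⊕ Fin (M + 1 - 2)) ≃ Fin (2 * M),
      (∀ t, (e (Sum.inl t)).val = 0 ∨ M ≤ (e (Sum.inl t)).val) ∧
      (∀ s, 1 ≤ (e (Sum.inr s)).val ∧ (e (Sum.inr s)).val < M) := by
  let g : (Fin (M + 1) ⊕ Fin (M + 1 - 2)) → Fin (2 * M) := Sum.elim
    (fun t => ⟨if t.val = 0 then 0 else M + t.val - 1, by have := t.2; split_ifs <;> omega⟩)
    (fun s => ⟨s.val + 1, by have := s.2; omega⟩)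
  have hgl : ∀ t, (g (Sum.inl t)).val = if t.val = 0 then 0 else M + t.val - 1 := fun t => rfl
  have hgr : ∀ s, (g (Sum.inr s)).val = s.val + 1 := fun s => rfl
  have hinj : Function.Injective g := by
    rintro (t | s) (t' | s') h <;> rw [Fin.ext_iff] at h
    · rw [hgl, hgl] at h
      have := t.2
      have := t'.2
      rw [Sum.inl.injEq, Fin.ext_iff]
      split_ifs at h <;> omega
    · rw [hgl, hgr] at h
      have := s'.2
      exfalso
      split_ifs at h
      omega
    · rw [hgl, hgr] at h
      have := s.2
      exfalso
      split_ifs at h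
      omega
    · rw [hgr, hgr] at h
      rw [Sum.inr.injEq, Fin.ext_iff]
      omega
  have hbij : Function.Bijective g := by
    rw [Fintype.bijective_iff_injective_and_card]
    refine ⟨hinj, ?_⟩
    simp only [Fintype.card_sum, Fintype.card_fin]
    omega
  refine ⟨Equiv.ofBijective g hbij, fun t => ?_, fun s => ?_⟩
  · rw [Equiv.ofBijective_apply, hgl]
    split_ifs <;> omega
  · rw [Equiv.ofBijective_apply, hgr]
    have := s.2
    omega

lemma ncard_neighborSet_comap_equiv {V W : Type*} (e : V ≃ W) (H : SimpleGraph W) (v : V) :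
    ((H.comap e).neighborSet v).ncard = (H.neighborSet (e v)).ncard := by
  rw [← Set.ncard_image_of_injective _ e.injective]
  congr 1
  ext w
  simp

/-- The full binary tree with `M` leaves and an extra root, as a full Steiner topology. -/
def halvingTopology {M : ℕ} (hM : 1 ≤ M) (e : SteinerVert (M + 1) ≃ Fin (2 * M))
    (hl : ∀ t, (e (Sum.inl t)).val = 0 ∨ M ≤ (e (Sum.inl t)).val)
    (hr : ∀ s, 1 ≤ (e (Sum.inr s)).val ∧ (e (Sum.inr s)).val < M) :
    FullSteinerTopology (M + 1) where
  graph := (halvingGraph (2 * M)).comap e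
  isTree := (SimpleGraph.Iso.comap e _).isTree_iff.2 (halvingGraph_isTree (by omega))
  degTerminal t := by
    rw [ncard_neighborSet_comap_equiv]
    exact ncard_neighborSet_halvingGraph_leaf (by omega) _ (hl t)
  degSteiner s := by
    rw [ncard_neighborSet_comap_equiv]
    exact ncard_neighborSet_halvingGraph_inner _ (hr s).1 (hr s).2

lemma treeLength_halvingTopology {M d : ℕ} (hM : 1 ≤ M) (e : SteinerVert (M + 1) ≃ Fin (2 * M))
    (hl : ∀ t, (e (Sum.inl t)).val = 0 ∨ M ≤ (e (Sum.inl t)).val)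
    (hr : ∀ s, 1 ≤ (e (Sum.inr s)).val ∧ (e (Sum.inr s)).val < M) (p : ℕ → Epc d) :
    treeLength (halvingTopology hM e hl hr) (fun v => p (e v))
      = ∑ j ∈ Finset.Ico 1 (2 * M), dist (p j) (p (j / 2)) := by
  classical
  have h := sum_halvingGraph_adj (N := 2 * M) (fun a b => dist (p a) (p b))
    (fun a b => dist_comm _ _)
  unfold treeLength
  rw [← Equiv.sum_comp e] at h
  simp_rw [← Equiv.sum_comp e (fun b => if (halvingGraph (2 * M)).Adj _ b then
    dist (p _) (p b) else 0)] at h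
  have hadj : ∀ u v, (halvingTopology hM e hl hr).graph.Adj u v
      ↔ (halvingGraph (2 * M)).Adj (e u) (e v) := fun u v => Iff.rfl
  simp_rw [hadj]
  rw [show (1 / 2 : ℝ) = 2⁻¹ by norm_num, inv_mul_eq_iff_eq_mul₀ two_ne_zero, ← h]

/-- Direction of the edge from `j / 2` to `j` in the tree all of whose angles are `2π/3`. -/
def heading (j : ℕ) : ℝ :=
  if _h : j ≤ 1 then 0 else heading (j / 2) + (if j % 2 = 0 then π / 3 else -(π / 3))
  decreasing_by omega

/-- The edge from `j / 2` to `j` when the directions of level `l` are turned by `φ l`. -/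
def edgeVec (φ : ℕ → ℝ) (j : ℕ) : ℂ :=
  ((1 / 2 : ℝ) ^ Nat.log 2 j : ℝ) * Complex.exp ((heading j + φ (Nat.log 2 j) : ℝ) * Complex.I)

/-- Position of node `j` in the tree with edges `edgeVec φ`. -/
def place (φ : ℕ → ℝ) (j : ℕ) : ℂ :=
  if _h : j = 0 then 0 else place φ (j / 2) + edgeVec φ j
  decreasing_by omega

/-- Displacement of node `j` that undoes the turning of the edges. -/
def shift (φ : ℕ → ℝ) (j : ℕ) : ℂ :=
  if j = 0 then 0 else
    ((1 / 2 : ℝ) ^ Nat.log 2 j * ∑ i ∈ Finset.range (Nat.log 2 j + 1), Real.sin (φ i) : ℝ)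
      * (Complex.I * Complex.exp ((heading j : ℝ) * Complex.I))

lemma heading_one : heading 1 = 0 := by
  rw [heading]; simp

lemma heading_two_mul {j : ℕ} (hj : 1 ≤ j) : heading (2 * j) = heading j + π / 3 := by
  rw [heading, dif_neg (by omega), if_pos (by omega), show 2 * j / 2 = j by omega]

lemma heading_two_mul_add_one {j : ℕ} (hj : 1 ≤ j) :
    heading (2 * j + 1) = heading j - π / 3 := by
  rw [heading, dif_neg (by omega), if_neg (by omega), show (2 * j + 1) / 2 = j by omega,
    sub_eq_add_neg]

lemma log_two_mul {j : ℕ} (hj : 1 ≤ j) : Nat.log 2 (2 * j) = Nat.log 2 j + 1 := by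
  rw [mul_comm, Nat.log_mul_base one_lt_two (by omega)]

lemma log_two_mul_add_one {j : ℕ} (hj : 1 ≤ j) : Nat.log 2 (2 * j + 1) = Nat.log 2 j + 1 := by
  have h := Nat.log_div_base 2 (2 * j + 1)
  rw [show (2 * j + 1) / 2 = j by omega] at h
  have h' : 1 ≤ Nat.log 2 (2 * j + 1) := Nat.log_pos one_lt_two (by omega)
  omega

lemma place_sub_parent (φ : ℕ → ℝ) {j : ℕ} (hj : 1 ≤ j) :
    place φ j - place φ (j / 2) = edgeVec φ j := by
  rw [place, dif_neg (by omega), add_sub_cancel_left]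

lemma norm_edgeVec (φ : ℕ → ℝ) (j : ℕ) : ‖edgeVec φ j‖ = (1 / 2) ^ Nat.log 2 j := by
  rw [edgeVec, norm_mul, Complex.norm_exp_ofReal_mul_I, mul_one, Complex.norm_real,
    Real.norm_of_nonneg (by positivity)]

lemma exp_add_mul_I (a b : ℝ) :
    Complex.exp ((a + b : ℝ) * Complex.I)
      = Complex.exp (a * Complex.I) * ((Real.cos b : ℂ) + Real.sin b * Complex.I) := by
  rw [Complex.ofReal_add, add_mul, Complex.exp_add, Complex.exp_mul_I (b : ℂ), Complex.ofReal_cos,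
    Complex.ofReal_sin]

lemma ofReal_sqrt_three_sq : ((√3 : ℝ) : ℂ) ^ 2 = 3 := by
  rw [← Complex.ofReal_pow, Real.sq_sqrt (by norm_num)]
  norm_num

lemma dist_shift_one (φ : ℕ → ℝ) (h : 0 ≤ Real.cos (φ 0)) :
    dist (place φ 1 - shift φ 1) (place φ (1 / 2) - shift φ (1 / 2)) = Real.cos (φ 0) := by
  have h1 := place_sub_parent φ (le_refl 1)
  have h2 : place φ 1 - shift φ 1 - (place φ (1 / 2) - shift φ (1 / 2)) = (Real.cos (φ 0) : ℝ) := by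
    rw [show ∀ a b c d : ℂ, a - b - (c - d) = (a - c) - b + d by intros; ring, h1]
    simp only [edgeVec, shift, heading_one, Nat.log_one_right]
    rw [exp_add_mul_I]
    simp
  rw [dist_eq_norm, h2, Complex.norm_real, Real.norm_of_nonneg h]

lemma dist_shift_two_mul (φ : ℕ → ℝ) {j : ℕ} (hj : 1 ≤ j)
    (h : 0 ≤ Real.cos (φ (Nat.log 2 j + 1))
      + √3 * ∑ i ∈ Finset.range (Nat.log 2 j + 1), Real.sin (φ i)) :
    dist (place φ (2 * j) - shift φ (2 * j))
      (place φ (2 * j / 2) - shift φ (2 * j / 2))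
      = (1 / 2) ^ (Nat.log 2 j + 1) * (Real.cos (φ (Nat.log 2 j + 1))
        + √3 * ∑ i ∈ Finset.range (Nat.log 2 j + 1), Real.sin (φ i)) := by
  have h1 := place_sub_parent φ (show 1 ≤ 2 * j by omega)
  set l := Nat.log 2 j with hl
  have h2 : place φ (2 * j) - shift φ (2 * j) - (place φ (2 * j / 2) - shift φ (2 * j / 2))
      = ((1 / 2) ^ (l + 1) * (Real.cos (φ (l + 1))
        + √3 * ∑ i ∈ Finset.range (l + 1), Real.sin (φ i)) : ℝ)
        * Complex.exp ((heading (2 * j) : ℝ) * Complex.I) := by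
    rw [show ∀ a b c d : ℂ, a - b - (c - d) = (a - c) - b + d by intros; ring, h1,
      show 2 * j / 2 = j by omega]
    rw [edgeVec, shift, shift, if_neg (by omega), if_neg (by omega), log_two_mul hj, ← hl,
      Finset.sum_range_succ _ (l + 1), exp_add_mul_I, heading_two_mul hj, exp_add_mul_I,
      Real.cos_pi_div_three, Real.sin_pi_div_three]
    push_cast
    ring_nf
    simp only [Complex.I_sq, ofReal_sqrt_three_sq]
    ring_nf
  rw [dist_eq_norm, h2, norm_mul, Complex.norm_exp_ofReal_mul_I, mul_one, Complex.norm_real,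
    Real.norm_of_nonneg (by positivity)]

lemma dist_shift_two_mul_add_one (φ : ℕ → ℝ) {j : ℕ} (hj : 1 ≤ j)
    (h : 0 ≤ Real.cos (φ (Nat.log 2 j + 1))
      - √3 * ∑ i ∈ Finset.range (Nat.log 2 j + 1), Real.sin (φ i)) :
    dist (place φ (2 * j + 1) - shift φ (2 * j + 1))
      (place φ ((2 * j + 1) / 2) - shift φ ((2 * j + 1) / 2))
      = (1 / 2) ^ (Nat.log 2 j + 1) * (Real.cos (φ (Nat.log 2 j + 1))
        - √3 * ∑ i ∈ Finset.range (Nat.log 2 j + 1), Real.sin (φ i)) := by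
  have h1 := place_sub_parent φ (show 1 ≤ 2 * j + 1 by omega)
  set l := Nat.log 2 j with hl
  have h2 : place φ (2 * j + 1) - shift φ (2 * j + 1)
      - (place φ ((2 * j + 1) / 2) - shift φ ((2 * j + 1) / 2))
      = ((1 / 2) ^ (l + 1) * (Real.cos (φ (l + 1))
        - √3 * ∑ i ∈ Finset.range (l + 1), Real.sin (φ i)) : ℝ)
        * Complex.exp ((heading (2 * j + 1) : ℝ) * Complex.I) := by
    rw [show ∀ a b c d : ℂ, a - b - (c - d) = (a - c) - b + d by intros; ring, h1,
      show (2 * j + 1) / 2 = j by omega]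
    rw [edgeVec, shift, shift, if_neg (by omega), if_neg (by omega), log_two_mul_add_one hj, ← hl,
      Finset.sum_range_succ _ (l + 1), exp_add_mul_I, heading_two_mul_add_one hj, sub_eq_add_neg (heading j),
      exp_add_mul_I (heading j), Real.cos_neg, Real.sin_neg,
      Real.cos_pi_div_three, Real.sin_pi_div_three]
    push_cast
    ring_nf
    simp only [Complex.I_sq, ofReal_sqrt_three_sq]
    ring_nf
  rw [dist_eq_norm, h2, norm_mul, Complex.norm_exp_ofReal_mul_I, mul_one, Complex.norm_real,
    Real.norm_of_nonneg (by positivity)]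

lemma angle_polar {r s x y : ℝ} (hr : 0 < r) (hs : 0 < s) (hxy : |x - y| < π) :
    InnerProductGeometry.angle ((r : ℂ) * Complex.exp (x * Complex.I))
      ((s : ℂ) * Complex.exp (y * Complex.I)) = |x - y| := by
  rw [← Complex.real_smul (x := r), ← Complex.real_smul (x := s), InnerProductGeometry.angle_smul_left_of_pos _ _ hr,
    InnerProductGeometry.angle_smul_right_of_pos _ _ hs, Complex.angle_exp_exp,
    (toIocMod_eq_self _).2]
  rw [abs_lt] at hxy
  constructor <;> linarith

section Angles

variable {φ : ℕ → ℝ} {ε : ℝ} {j : ℕ}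

lemma place_two_mul_sub (hφ : ∀ l, φ (l + 1) = φ l - ε) (hj : 1 ≤ j) :
    place φ (2 * j) - place φ j = ((1 / 2 : ℝ) ^ (Nat.log 2 j + 1) : ℝ)
      * Complex.exp ((heading j + φ (Nat.log 2 j) + π / 3 - ε : ℝ) * Complex.I) := by
  have h := place_sub_parent φ (show 1 ≤ 2 * j by omega)
  rw [show 2 * j / 2 = j by omega] at h
  rw [h, edgeVec, log_two_mul hj, heading_two_mul hj, hφ]
  congr 4
  ring

lemma place_two_mul_add_one_sub (hφ : ∀ l, φ (l + 1) = φ l - ε) (hj : 1 ≤ j) :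
    place φ (2 * j + 1) - place φ j = ((1 / 2 : ℝ) ^ (Nat.log 2 j + 1) : ℝ)
      * Complex.exp ((heading j + φ (Nat.log 2 j) - π / 3 - ε : ℝ) * Complex.I) := by
  have h := place_sub_parent φ (show 1 ≤ 2 * j + 1 by omega)
  rw [show (2 * j + 1) / 2 = j by omega] at h
  rw [h, edgeVec, log_two_mul_add_one hj, heading_two_mul_add_one hj, hφ]
  congr 4
  ring

lemma place_parent_sub_add_pi (hj : 1 ≤ j) :
    place φ (j / 2) - place φ j = ((1 / 2 : ℝ) ^ Nat.log 2 j : ℝ)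
      * Complex.exp ((heading j + φ (Nat.log 2 j) + π : ℝ) * Complex.I) := by
  rw [← neg_sub, place_sub_parent φ hj, edgeVec, exp_add_mul_I _ π, Real.cos_pi, Real.sin_pi]
  push_cast
  ring

lemma place_parent_sub_sub_pi (hj : 1 ≤ j) :
    place φ (j / 2) - place φ j = ((1 / 2 : ℝ) ^ Nat.log 2 j : ℝ)
      * Complex.exp ((heading j + φ (Nat.log 2 j) - π : ℝ) * Complex.I) := by
  rw [← neg_sub, place_sub_parent φ hj, edgeVec, sub_eq_add_neg _ π, exp_add_mul_I _ (-π),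
    Real.cos_neg, Real.sin_neg, Real.cos_pi, Real.sin_pi]
  push_cast
  ring

lemma angle_place_bound (hφ : ∀ l, φ (l + 1) = φ l - ε) (hε0 : 0 ≤ ε) (hε1 : ε < 1) (hj : 1 ≤ j)
    {a b : ℕ} (ha : a = j / 2 ∨ a = 2 * j ∨ a = 2 * j + 1)
    (hb : b = j / 2 ∨ b = 2 * j ∨ b = 2 * j + 1) (hab : a ≠ b) :
    |EuclideanGeometry.angle (place φ a) (place φ j) (place φ b) - 2 * π / 3| ≤ ε := by
  have hπ := Real.pi_gt_three
  have hp : ∀ n : ℕ, 0 < (1 / 2 : ℝ) ^ n := fun n => by positivity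
  have e1 : EuclideanGeometry.angle (place φ (j / 2)) (place φ j) (place φ (2 * j))
      = 2 * π / 3 + ε := by
    rw [EuclideanGeometry.angle, vsub_eq_sub, vsub_eq_sub, place_two_mul_sub hφ hj,
      place_parent_sub_add_pi hj, angle_polar (hp _) (hp _)]
    · rw [abs_of_nonneg] <;> linarith
    · rw [abs_lt]; constructor <;> linarith
  have e2 : EuclideanGeometry.angle (place φ (j / 2)) (place φ j) (place φ (2 * j + 1))
      = 2 * π / 3 - ε := by
    rw [EuclideanGeometry.angle, vsub_eq_sub, vsub_eq_sub, place_two_mul_add_one_sub hφ hj,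
      place_parent_sub_sub_pi hj, angle_polar (hp _) (hp _)]
    · rw [abs_of_nonpos] <;> linarith
    · rw [abs_lt]; constructor <;> linarith
  have e3 : EuclideanGeometry.angle (place φ (2 * j)) (place φ j) (place φ (2 * j + 1))
      = 2 * π / 3 := by
    rw [EuclideanGeometry.angle, vsub_eq_sub, vsub_eq_sub, place_two_mul_sub hφ hj,
      place_two_mul_add_one_sub hφ hj, angle_polar (hp _) (hp _)]
    · rw [abs_of_nonneg] <;> linarith
    · rw [abs_lt]; constructor <;> linarith
  have e1' := (EuclideanGeometry.angle_comm _ _ _).trans e1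
  have e2' := (EuclideanGeometry.angle_comm _ _ _).trans e2
  have e3' := (EuclideanGeometry.angle_comm _ _ _).trans e3
  rcases ha with rfl | rfl | rfl <;> rcases hb with rfl | rfl | rfl <;>
    first
      | exact absurd rfl hab
      | (first | rw [e1] | rw [e2] | rw [e3] | rw [e1'] | rw [e2'] | rw [e3']
         rw [abs_le]
         constructor <;> linarith)

end Angles

section Estimates

variable {k : ℕ} {ε : ℝ}

lemma sum_range_sub_sq (a : ℝ) (n : ℕ) :
    ∑ i ∈ Finset.range n, (a - i) ^ 2
      = n * a ^ 2 - a * n * (n - 1) + (n - 1) * n * (2 * n - 1) / 6 := by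
  induction n with
  | zero => simp
  | succ n ih =>
    rw [Finset.sum_range_succ, ih]
    push_cast
    ring

lemma sum_turn_sq : ∑ i ∈ Finset.range (k + 1), (((k : ℝ) / 2 - i) * ε) ^ 2
    = ε ^ 2 * (k * (k + 1) * (k + 2)) / 12 := by
  simp_rw [mul_pow]
  rw [← Finset.sum_mul, sum_range_sub_sq]
  push_cast
  ring

lemma turn_sq_le (hk : 1 ≤ k) (hε0 : 0 ≤ ε) (hε : ε * (k : ℝ) ^ 2 ≤ 1) {i : ℕ} (hi : i ≤ k) :
    (((k : ℝ) / 2 - i) * ε) ^ 2 * (4 * (k : ℝ) ^ 2) ≤ 1 := by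
  have hk' : (1 : ℝ) ≤ k := by exact_mod_cast hk
  have hi' : (i : ℝ) ≤ k := by exact_mod_cast hi
  have hi0 : (0 : ℝ) ≤ i := by positivity
  have h1 : ((k : ℝ) / 2 - i) ^ 2 ≤ ((k : ℝ) / 2) ^ 2 := by nlinarith
  calc (((k : ℝ) / 2 - i) * ε) ^ 2 * (4 * (k : ℝ) ^ 2)
      = ((k : ℝ) / 2 - i) ^ 2 * (ε ^ 2 * (4 * (k : ℝ) ^ 2)) := by ring
    _ ≤ ((k : ℝ) / 2) ^ 2 * (ε ^ 2 * (4 * (k : ℝ) ^ 2)) := by gcongr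
    _ = (ε * (k : ℝ) ^ 2) ^ 2 := by ring
    _ ≤ 1 := pow_le_one₀ (by positivity) hε

lemma sum_sin_turn : ∑ i ∈ Finset.range (k + 1), Real.sin (((k : ℝ) / 2 - i) * ε) = 0 := by
  have h := Finset.sum_range_reflect (fun i : ℕ => Real.sin (((k : ℝ) / 2 - i) * ε)) (k + 1)
  have h2 : ∑ i ∈ Finset.range (k + 1), Real.sin (((k : ℝ) / 2 - (k + 1 - 1 - i : ℕ)) * ε)
      = -∑ i ∈ Finset.range (k + 1), Real.sin (((k : ℝ) / 2 - i) * ε) := by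
    rw [← Finset.sum_neg_distrib]
    refine Finset.sum_congr rfl fun i hi => ?_
    rw [← Real.sin_neg, show k + 1 - 1 - i = k - i by omega,
      Nat.cast_sub (by have := Finset.mem_range.1 hi; omega)]
    congr 1
    ring
  linarith

lemma sum_sin_turn_sq_le (hk : 1 ≤ k) (hε0 : 0 ≤ ε) (hε : ε * (k : ℝ) ^ 2 ≤ 1) {l : ℕ}
    (hl : l ≤ k + 1) :
    (∑ i ∈ Finset.range l, Real.sin (((k : ℝ) / 2 - i) * ε)) ^ 2 ≤ 1 / 4 := by
  have hk' : (1 : ℝ) ≤ k := by exact_mod_cast hk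
  set f : ℕ → ℝ := fun i => Real.sin (((k : ℝ) / 2 - i) * ε) with hf
  have hsplit : ∑ i ∈ Finset.range l, f i + ∑ i ∈ Finset.Ico l (k + 1), f i = 0 := by
    rw [Finset.sum_range_add_sum_Ico f hl]
    exact sum_sin_turn
  have habs : 2 * |∑ i ∈ Finset.range l, f i| ≤ ∑ i ∈ Finset.range (k + 1), |f i| := by
    have h1 := Finset.abs_sum_le_sum_abs f (Finset.range l)
    have h2 := Finset.abs_sum_le_sum_abs f (Finset.Ico l (k + 1))
    rw [show ∑ i ∈ Finset.Ico l (k + 1), f i = -∑ i ∈ Finset.range l, f i by linarith,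
      abs_neg] at h2
    rw [← Finset.sum_range_add_sum_Ico (fun i => |f i|) hl]
    linarith
  have hsq : (∑ i ∈ Finset.range (k + 1), |f i|) ^ 2 ≤ 1 := by
    calc (∑ i ∈ Finset.range (k + 1), |f i|) ^ 2
        ≤ (Finset.range (k + 1)).card * ∑ i ∈ Finset.range (k + 1), |f i| ^ 2 :=
          sq_sum_le_card_mul_sum_sq
      _ ≤ (k + 1) * ∑ i ∈ Finset.range (k + 1), (((k : ℝ) / 2 - i) * ε) ^ 2 := by
          rw [Finset.card_range]
          push_cast
          refine mul_le_mul_of_nonneg_left (Finset.sum_le_sum fun i _ => ?_) (by positivity)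
          exact sq_le_sq.2 (by rw [abs_abs]; exact Real.abs_sin_le_abs)
      _ = ε ^ 2 * ((k + 1) * (k * (k + 1) * (k + 2)) / 12) := by rw [sum_turn_sq]; ring
      _ ≤ ε ^ 2 * (2 * k * (k * (2 * k) * (3 * k)) / 12) := by
          gcongr <;> linarith
      _ = (ε * (k : ℝ) ^ 2) ^ 2 := by ring
      _ ≤ 1 := pow_le_one₀ (by positivity) hε
  have hS : (2 * |∑ i ∈ Finset.range l, f i|) ^ 2 ≤ 1 :=
    (pow_le_pow_left₀ (by positivity) habs 2).trans hsq
  rw [mul_pow, sq_abs] at hS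
  linarith

lemma sqrt_three_mul_sum_sin_le_cos (hk : 1 ≤ k) (hε0 : 0 ≤ ε) (hε : ε * (k : ℝ) ^ 2 ≤ 1)
    {l m : ℕ} (hl : l ≤ k + 1) (hm : m ≤ k) :
    |√3 * ∑ i ∈ Finset.range l, Real.sin (((k : ℝ) / 2 - i) * ε)|
      ≤ Real.cos (((k : ℝ) / 2 - m) * ε) := by
  have hk' : (1 : ℝ) ≤ k := by exact_mod_cast hk
  have hS := sum_sin_turn_sq_le hk hε0 hε hl
  have hφ := turn_sq_le hk hε0 hε hm
  have hcos := Real.one_sub_sq_div_two_le_cos (x := ((k : ℝ) / 2 - m) * ε)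
  have hφ' : (((k : ℝ) / 2 - m) * ε) ^ 2 ≤ 1 / 4 := by
    nlinarith [sq_nonneg (((k : ℝ) / 2 - m) * ε), mul_self_nonneg ((k : ℝ) - 1)]
  refine (abs_le_of_sq_le_sq ?_ (by norm_num : (0 : ℝ) ≤ 7 / 8)).trans ?_
  · rw [mul_pow, Real.sq_sqrt (by norm_num)]
    linarith
  · linarith

lemma sum_cos_turn_bound (hk : 1 ≤ k) (hε0 : 0 < ε) (hε : ε * (k : ℝ) ^ 2 ≤ 1) :
    (1 + ε ^ 2 * (k : ℝ) ^ 2 / 24)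
      * ∑ i ∈ Finset.range (k + 1), Real.cos (((k : ℝ) / 2 - i) * ε) < k + 1 := by
  have hk' : (1 : ℝ) ≤ k := by exact_mod_cast hk
  have hterm : ∀ i ∈ Finset.range (k + 1), Real.cos (((k : ℝ) / 2 - i) * ε)
      ≤ 1 - (((k : ℝ) / 2 - i) * ε) ^ 2 * (1 / 2 - 5 / (384 * (k : ℝ) ^ 2)) := by
    intro i hi
    have hφ := turn_sq_le hk hε0.le hε (Nat.lt_succ_iff.1 (Finset.mem_range.1 hi))
    set x := ((k : ℝ) / 2 - i) * ε
    have hx1 : x ^ 2 ≤ 1 / (4 * (k : ℝ) ^ 2) := by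
      rw [le_div_iff₀ (by positivity)]
      exact hφ
    have hx : |x| ≤ 1 := by
      rw [← sq_le_one_iff_abs_le_one]
      nlinarith [sq_nonneg x]
    have hb := (abs_le.1 (Real.cos_bound hx)).2
    have h4 : |x| ^ 4 ≤ x ^ 2 * (1 / (4 * (k : ℝ) ^ 2)) := by
      rw [show |x| ^ 4 = (|x| ^ 2) ^ 2 by ring, sq_abs, sq]
      gcongr
    have h5 : x ^ 2 * (1 / (4 * (k : ℝ) ^ 2)) * (5 / 96) = x ^ 2 * (5 / (384 * (k : ℝ) ^ 2)) := by
      field_simp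
      ring
    linarith
  have hsum := Finset.sum_le_sum hterm
  rw [Finset.sum_sub_distrib, ← Finset.sum_mul, sum_turn_sq] at hsum
  simp only [Finset.sum_const, Finset.card_range, nsmul_eq_mul, mul_one] at hsum
  push_cast at hsum
  set q := ε ^ 2 * (k : ℝ) ^ 2 / 24 with hq
  have hq0 : 0 < q := by positivity
  have hB : q * (k + 1) < ε ^ 2 * (k * (k + 1) * (k + 2)) / 12
      * (1 / 2 - 5 / (384 * (k : ℝ) ^ 2)) := by
    have hid : ε ^ 2 * (k * (k + 1) * (k + 2)) / 12 * (1 / 2 - 5 / (384 * (k : ℝ) ^ 2))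
        - q * (k + 1)
        = ε ^ 2 * (k + 1) * (2 * k - 5 * (k + 2) / (192 * k)) / 24 := by
      rw [hq]
      field_simp
      ring
    have hpos : 0 < 2 * (k : ℝ) - 5 * (k + 2) / (192 * k) := by
      rw [sub_pos, div_lt_iff₀ (by positivity)]
      nlinarith
    have : 0 < ε ^ 2 * (k + 1) * (2 * (k : ℝ) - 5 * (k + 2) / (192 * k)) / 24 := by positivity
    linarith
  have hB0 := (mul_pos hq0 (show (0 : ℝ) < k + 1 by positivity)).trans hB
  nlinarith

end Estimates

lemma sum_Ico_one_two_mul (f : ℕ → ℝ) (M : ℕ) (hM : 1 ≤ M) :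
    ∑ j ∈ Finset.Ico 1 (2 * M), f j
      = f 1 + ∑ j ∈ Finset.Ico 1 M, (f (2 * j) + f (2 * j + 1)) := by
  induction M, hM using Nat.le_induction with
  | base => simp
  | succ M hM ih =>
    rw [show 2 * (M + 1) = 2 * M + 1 + 1 by ring, Finset.sum_Ico_succ_top (by omega),
      Finset.sum_Ico_succ_top (by omega), ih, Finset.sum_Ico_succ_top hM]
    ring

lemma sum_Ico_log (g : ℕ → ℝ) (k : ℕ) :
    ∑ j ∈ Finset.Ico 1 (2 ^ k), (1 / 2 : ℝ) ^ Nat.log 2 j * g (Nat.log 2 j)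
      = ∑ l ∈ Finset.range k, g l := by
  induction k generalizing g with
  | zero => simp
  | succ k ih =>
    rw [pow_succ', sum_Ico_one_two_mul _ _ Nat.one_le_two_pow, Finset.sum_range_succ',
      ← ih (fun l => g (l + 1)), add_comm]
    congr 1
    · refine Finset.sum_congr rfl fun j hj => ?_
      have hj1 := (Finset.mem_Ico.1 hj).1
      rw [log_two_mul hj1, log_two_mul_add_one hj1]
      ring
    · simp

/-- The linear isometry between `ℂ` and the Euclidean plane. -/
abbrev toPlane : ℂ ≃ₗᵢ[ℝ] Epc 2 := Complex.orthonormalBasisOneI.repr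

lemma angle_toPlane (a b c : ℂ) :
    EuclideanGeometry.angle (toPlane a) (toPlane b) (toPlane c) = EuclideanGeometry.angle a b c := by
  simp only [EuclideanGeometry.angle, vsub_eq_sub, ← map_sub]
  exact LinearIsometry.angle_map toPlane.toLinearIsometry _ _

/-- For every `k ≥ 1` and `0 < c < 1`, if `ε = c/k²` then `F₂(ε, 2^k + 1) > (c/24)·ε`:
there is a full `ε`-approximate Steiner tree `T` on `2^k + 1` terminals in `ℝ²` with
`L(T) > (1 + (c/24)ε)·L(S(T))`. -/
theorem steiner_plane_lower_bound (k : ℕ) (hk : 1 ≤ k) (c : ℝ) (hc0 : 0 < c) (hc1 : c < 1)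
    (ε : ℝ) (hε : ε = c / (k : ℝ) ^ 2) :
    ∃ (G : FullSteinerTopology (2 ^ k + 1)) (pos : SteinerVert (2 ^ k + 1) → Epc 2),
      IsApproxSteiner ε G pos ∧
      treeLength G pos > (1 + (c / 24) * ε) * minTreeLength G pos := by
  have hk' : (1 : ℝ) ≤ k := by exact_mod_cast hk
  have hc : c = ε * (k : ℝ) ^ 2 := by rw [hε]; field_simp
  have hε0 : 0 < ε := by rw [hε]; positivity
  have hε1 : ε < 1 := by nlinarith
  have hεk : ε * (k : ℝ) ^ 2 ≤ 1 := by linarith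
  have hM : 1 ≤ 2 ^ k := Nat.one_le_two_pow
  obtain ⟨e, hl, hr⟩ := exists_labelling (2 ^ k) hM
  let φ : ℕ → ℝ := fun l => ((k : ℝ) / 2 - l) * ε
  have hφ : ∀ l, φ (l + 1) = φ l - ε := fun l => by simp only [φ]; push_cast; ring
  have hcos : ∀ {l m : ℕ}, l ≤ k + 1 → m ≤ k →
      |√3 * ∑ i ∈ Finset.range l, Real.sin (φ i)| ≤ Real.cos (φ m) :=
    fun hl hm => sqrt_three_mul_sum_sin_le_cos hk hε0.le hεk hl hm
  refine ⟨halvingTopology hM e hl hr, fun v => toPlane (place φ (e v)), ?_, ?_⟩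
  · intro s u v hu hv huv
    rw [angle_toPlane]
    have hnode : ∀ w, (halvingTopology hM e hl hr).graph.Adj (Sum.inr s) w →
        (e w).val = (e (Sum.inr s)).val / 2 ∨ (e w).val = 2 * (e (Sum.inr s)).val
          ∨ (e w).val = 2 * (e (Sum.inr s)).val + 1 := by
      intro w hw
      have hw' : (_ ∧ _) ∨ (_ ∧ _) := hw
      omega
    exact angle_place_bound hφ hε0.le hε1 (hr s).1 (hnode u hu) (hnode v hv)
      fun h => huv (e.injective (Fin.ext h))
  · have hlenT : treeLength (halvingTopology hM e hl hr) (fun v => toPlane (place φ (e v)))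
        = k + 1 := by
      rw [treeLength_halvingTopology hM e hl hr (fun j => toPlane (place φ j))]
      have h : ∀ j ∈ Finset.Ico 1 (2 * 2 ^ k), dist (toPlane (place φ j))
          (toPlane (place φ (j / 2))) = (1 / 2 : ℝ) ^ Nat.log 2 j * 1 := by
        intro j hj
        rw [LinearIsometryEquiv.dist_map, dist_eq_norm,
          place_sub_parent φ (Finset.mem_Ico.1 hj).1, norm_edgeVec, mul_one]
      rw [Finset.sum_congr rfl h, ← pow_succ', sum_Ico_log (fun _ => 1)]
      simp
    have hlenS : treeLength (halvingTopology hM e hl hr)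
        (fun v => toPlane (place φ (e v) - shift φ (e v)))
        = ∑ l ∈ Finset.range (k + 1), Real.cos (φ l) := by
      rw [treeLength_halvingTopology hM e hl hr (fun j => toPlane (place φ j - shift φ j)),
        sum_Ico_one_two_mul _ _ hM, Finset.sum_range_succ', ← sum_Ico_log, add_comm]
      simp_rw [LinearIsometryEquiv.dist_map]
      congr 1
      · refine Finset.sum_congr rfl fun j hj => ?_
        obtain ⟨hj1, hj2⟩ := Finset.mem_Ico.1 hj
        have hlog : Nat.log 2 j + 1 ≤ k := Nat.log_lt_of_lt_pow (by omega) hj2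
        have hb := abs_le.1 (hcos (show Nat.log 2 j + 1 ≤ k + 1 by omega) hlog)
        rw [dist_shift_two_mul φ hj1 (by linarith [hb.1]),
          dist_shift_two_mul_add_one φ hj1 (by linarith [hb.2])]
        ring
      · exact dist_shift_one φ ((abs_nonneg _).trans (hcos (Nat.zero_le _) (Nat.zero_le k)))
    have hshift : ∀ t : Fin (2 ^ k + 1), shift φ (e (Sum.inl t)) = 0 := by
      intro t
      rw [shift]
      rcases hl t with h | h
      · rw [if_pos h]
      · have hlog : Nat.log 2 (e (Sum.inl t)).val = k := by
          refine (Nat.log_eq_iff (Or.inl (by omega))).2 ⟨h, ?_⟩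
          rw [pow_succ']
          exact (e (Sum.inl t)).2
        rw [hlog, show ∑ i ∈ Finset.range (k + 1), Real.sin (φ i) = 0 from sum_sin_turn]
        simp
    have hmin : minTreeLength (halvingTopology hM e hl hr) (fun v => toPlane (place φ (e v)))
        ≤ ∑ l ∈ Finset.range (k + 1), Real.cos (φ l) := by
      refine csInf_le ⟨0, ?_⟩ ⟨fun v => toPlane (place φ (e v) - shift φ (e v)), fun t => ?_,
        hlenS.symm⟩
      · rintro _ ⟨p, -, rfl⟩
        unfold treeLength
        refine mul_nonneg (by norm_num) (Finset.sum_nonneg fun u _ => Finset.sum_nonneg fun v _ => ?_)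
        split_ifs
        · exact dist_nonneg
        · exact le_rfl
      · simp only [hshift, sub_zero]
    have hfac : 1 + c / 24 * ε = 1 + ε ^ 2 * (k : ℝ) ^ 2 / 24 := by rw [hc]; ring
    rw [hlenT, hfac, gt_iff_lt]
    exact (mul_le_mul_of_nonneg_left hmin (by positivity)).trans_lt
      (sum_cos_turn_bound hk hε0 hεk)

end
end

section
/- For every integer k ≥ 1 and every real c with 0 < c < 1, if ε = c/k² then G_2(ε, 2^k + 1) > (c/24)·ε; that is, there exists a full ε-approximate Steiner tree T on 2^k + 1 terminals in ℝ² whose shortest same-topology tree S(T) is a non-degenerate locally minimum Steiner tree and which satisfies L(T) > (1 + (c/24)ε)·L(S(T)). -/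
open Real

noncomputable section

/-- The undirected graph joining every vertex other than the root `r` to its parent. -/
def parentGraph {V : Type*} (par : V → V) (r : V) : SimpleGraph V :=
  SimpleGraph.fromRel fun u v => u ≠ r ∧ par u = v

section ParentGraph

variable {V : Type*} {par : V → V} {r : V} {rank : V → ℕ}

theorem parentGraph_adj (h : ∀ v, v ≠ r → rank (par v) < rank v) {u v : V} :
    (parentGraph par r).Adj u v ↔ (u ≠ r ∧ par u = v) ∨ (v ≠ r ∧ par v = u) := by
  unfold parentGraph
  rw [SimpleGraph.fromRel_adj]
  refine ⟨fun H => H.2, fun H => ⟨?_, H⟩⟩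
  rintro rfl
  have : u ≠ r ∧ par u = u := by tauto
  have h1 := h u this.1
  rw [this.2] at h1
  exact lt_irrefl _ h1

theorem parentGraph_isTree [Finite V] (h : ∀ v, v ≠ r → rank (par v) < rank v) :
    (parentGraph par r).IsTree := by
  classical
  have := Fintype.ofFinite V
  rw [SimpleGraph.isTree_iff_connected_and_card]
  constructor
  · have key : ∀ n, ∀ v, rank v ≤ n → (parentGraph par r).Reachable v r := by
      intro n
      induction n with
      | zero =>
        intro v hv
        by_cases hr : v = r
        · rw [hr]
        · have := h v hr
          omega
      | succ n ih =>
        intro v hv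
        by_cases hr : v = r
        · rw [hr]
        · have h1 := h v hr
          have h2 : (parentGraph par r).Adj v (par v) := (parentGraph_adj h).2 (Or.inl ⟨hr, rfl⟩)
          exact h2.reachable.trans (ih _ (by omega))
    have : Nonempty V := ⟨r⟩
    exact ⟨fun u v => (key _ u le_rfl).trans (key _ v le_rfl).symm⟩
  · have e : {v : V // v ≠ r} ≃ (parentGraph par r).edgeSet := by
      refine Equiv.ofBijective
        (fun v => ⟨s(v.1, par v.1), (parentGraph_adj h).2 (Or.inl ⟨v.2, rfl⟩)⟩) ⟨?_, ?_⟩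
      · rintro ⟨u, hu⟩ ⟨v, hv⟩ huv
        rcases Sym2.eq_iff.1 (congrArg Subtype.val huv) with huv | huv
        · exact Subtype.ext huv.1
        · have h1 := h u hu
          have h2 := h v hv
          rw [huv.2] at h1
          rw [← huv.1] at h2
          exact absurd h1 (not_lt_of_gt h2)
      · rintro ⟨z, hz⟩
        induction z using Sym2.ind with
        | _ u v =>
          rcases (parentGraph_adj h).1 hz with H | H
          · exact ⟨⟨u, H.1⟩, by simp [H.2]⟩
          · exact ⟨⟨v, H.1⟩, by simp [H.2, Sym2.eq_swap]⟩
    rw [← Nat.card_congr e, Nat.card_eq_fintype_card, Nat.card_eq_fintype_card,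
      Fintype.card_subtype_compl, Fintype.card_subtype_eq]
    have : 0 < Fintype.card V := Fintype.card_pos_iff.2 ⟨r⟩
    omega

open Classical in
theorem sum_parentGraph_adj [Fintype V] (h : ∀ v, v ≠ r → rank (par v) < rank v)
    {f : V → V → ℝ} (hf : ∀ u v, f u v = f v u) {g : V → ℝ} (hgr : g r = 0)
    (hg : ∀ v, v ≠ r → f v (par v) = g v) :
    (∑ u, ∑ v, if (parentGraph par r).Adj u v then f u v else 0) = 2 * ∑ v, g v := by
  have h1 : ∀ u v, (if (parentGraph par r).Adj u v then f u v else 0) =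
      (if u ≠ r ∧ par u = v then f u v else 0) + (if v ≠ r ∧ par v = u then f v u else 0) := by
    intro u v
    by_cases h1 : u ≠ r ∧ par u = v <;> by_cases h2 : v ≠ r ∧ par v = u
    · have a := h u h1.1
      have b := h v h2.1
      rw [h1.2] at a
      rw [h2.2] at b
      omega
    all_goals
      have := @parentGraph_adj V par r rank h u v
      simp [this, h1, h2, hf u v]
  have h2 : ∀ u, (∑ v, if u ≠ r ∧ par u = v then f u v else 0) =
      g u := by
    intro u
    by_cases hu : u = r
    · simp [hu, hgr]
    · simp [hu, hg]
  simp only [h1, Finset.sum_add_distrib]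
  rw [Finset.sum_comm (f := fun u v => if v ≠ r ∧ par v = u then f v u else 0)]
  simp only [h2]
  ring

end ParentGraph

section Balanced

open Classical in
/-- If the unit vectors along the edges of a drawing `p` of a graph are balanced at every vertex
outside `s`, then the projections onto these directions of the edges of a second drawing that
agrees with `p` on `s` add up to the total edge length of `p`. -/
theorem sum_inner_eq_sum_dist_of_balanced {V E : Type*} [Fintype V] [NormedAddCommGroup E]
    [InnerProductSpace ℝ E] (G : SimpleGraph V) (s : Set V) (p q : V → E)
    (hbal : ∀ x, x ∉ s → (∑ v, if G.Adj x v then ‖p x - p v‖⁻¹ • (p x - p v) else 0) = 0)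
    (hpq : ∀ x ∈ s, q x = p x) :
    (∑ u, ∑ v, if G.Adj u v then inner ℝ (q u - q v) (‖p u - p v‖⁻¹ • (p u - p v)) else 0) =
      ∑ u, ∑ v, if G.Adj u v then dist (p u) (p v) else 0 := by
  set n : V → V → E := fun u v => ‖p u - p v‖⁻¹ • (p u - p v) with hn
  have hanti : ∀ u v, n v u = - n u v := by
    intro u v
    simp only [hn]
    rw [norm_sub_rev, ← smul_neg, neg_sub]
  have hself : ∀ u v, inner ℝ (p u - p v) (n u v) = dist (p u) (p v) := by
    intro u v
    simp only [hn, inner_smul_right, real_inner_self_eq_norm_sq, dist_eq_norm]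
    by_cases h0 : ‖p u - p v‖ = 0
    · simp [h0]
    · field_simp
  set d : V → E := fun v => q v - p v with hd
  have hsplit : ∀ u v, inner ℝ (q u - q v) (n u v) =
      dist (p u) (p v) + (inner ℝ (d u) (n u v) + inner ℝ (d v) (n v u)) := by
    intro u v
    rw [← hself, hanti u v, inner_neg_right, ← sub_eq_add_neg, ← inner_sub_left, ← inner_add_left]
    congr 1
    simp only [hd]
    abel
  have hzero : ∀ u, (∑ v, if G.Adj u v then inner ℝ (d u) (n u v) else 0) = 0 := by
    intro u
    by_cases hu : u ∈ s
    · simp [hd, hpq u hu]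
    · have := congrArg (fun z => inner ℝ (d u) z) (hbal u hu)
      simp only [inner_sum, inner_zero_right] at this
      refine Eq.trans (Finset.sum_congr rfl fun v _ => ?_) this
      split_ifs <;> simp [hn]
  have hL : ∀ u v, (if G.Adj u v then inner ℝ (q u - q v) (n u v) else 0) =
      (if G.Adj u v then dist (p u) (p v) else 0) +
      ((if G.Adj u v then inner ℝ (d u) (n u v) else 0) +
       (if G.Adj v u then inner ℝ (d v) (n v u) else 0)) := by
    intro u v
    by_cases h : G.Adj u v
    · simp [h, h.symm, hsplit]
    · have h' : ¬ G.Adj v u := fun h' => h h'.symm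
      simp [h, h']
  change (∑ u, ∑ v, if G.Adj u v then inner ℝ (q u - q v) (n u v) else 0) = _
  simp only [hL, Finset.sum_add_distrib, hzero]
  rw [Finset.sum_comm (f := fun u v => if G.Adj v u then inner ℝ (d v) (n v u) else 0)]
  simp [hzero]

end Balanced

section Transfer

open Classical in
/-- A full Steiner topology on arbitrary finite types of terminals and Steiner points, with an
exact drawing `p` and an approximate drawing `q` in the complex plane, yields the same data on
numbered vertices in the Euclidean plane. -/
theorem exists_steiner_tree_of_drawing {τ σ : Type*} [Fintype τ] [Fintype σ] {m : ℕ}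
    (hτ : Fintype.card τ = m) (hσ : Fintype.card σ = m - 2) (G : SimpleGraph (τ ⊕ σ))
    (hG : G.IsTree) (hdeg₁ : ∀ t, (G.neighborSet (Sum.inl t)).ncard = 1)
    (hdeg₃ : ∀ s, (G.neighborSet (Sum.inr s)).ncard = 3) (p q : τ ⊕ σ → ℂ) (ε C : ℝ)
    (hq : ∀ s u v, G.Adj (Sum.inr s) u → G.Adj (Sum.inr s) v → u ≠ v →
      |InnerProductGeometry.angle (q u - q (Sum.inr s)) (q v - q (Sum.inr s)) - 2 * π / 3| ≤ ε)
    (hp : ∀ s u v, G.Adj (Sum.inr s) u → G.Adj (Sum.inr s) v → u ≠ v →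
      InnerProductGeometry.angle (p u - p (Sum.inr s)) (p v - p (Sum.inr s)) = 2 * π / 3)
    (hne : ∀ u v, G.Adj u v → p u ≠ p v)
    (hbal : ∀ s, (∑ v, if G.Adj (Sum.inr s) v then
      ‖p (Sum.inr s) - p v‖⁻¹ • (p (Sum.inr s) - p v) else 0) = 0)
    (hpq : ∀ t, p (Sum.inl t) = q (Sum.inl t))
    (hgap : C * (∑ u, ∑ v, if G.Adj u v then dist (p u) (p v) else 0) <
      ∑ u, ∑ v, if G.Adj u v then
        dist (q u) (q v) - inner ℝ (q u - q v) (‖p u - p v‖⁻¹ • (p u - p v)) else 0) :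
    ∃ (T : FullSteinerTopology m) (pos pos' : SteinerVert m → Epc 2),
      IsApproxSteiner ε T pos ∧
      (∀ t : Fin m, pos' (Sum.inl t) = pos (Sum.inl t)) ∧
      treeLength T pos' = minTreeLength T pos ∧
      IsLocallyMinimumTree T pos' ∧
      treeLength T pos > (1 + C) * treeLength T pos' := by
  let e : SteinerVert m ≃ τ ⊕ σ :=
    Equiv.sumCongr (Fintype.equivFinOfCardEq hτ).symm (Fintype.equivFinOfCardEq hσ).symm
  let J : ℂ ≃ₗᵢ[ℝ] Epc 2 := Complex.orthonormalBasisOneI.repr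
  have hnb : ∀ x, ((G.comap e).neighborSet x).ncard = (G.neighborSet (e x)).ncard := by
    intro x
    have : (G.comap e).neighborSet x = e ⁻¹' (G.neighborSet (e x)) := by
      ext y; simp
    rw [this]
    exact Set.ncard_preimage_of_injective_subset_range e.injective (by simp)
  let T : FullSteinerTopology m :=
    { graph := G.comap e
      isTree := (SimpleGraph.Iso.comap e G).isTree_iff.2 hG
      degTerminal := fun t => by rw [hnb]; exact hdeg₁ _
      degSteiner := fun s => by rw [hnb]; exact hdeg₃ _ }
  have hadj : ∀ u v, T.graph.Adj u v ↔ G.Adj (e u) (e v) := fun u v => Iff.rfl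
  have hangle : ∀ (r : τ ⊕ σ → ℂ) u v w, EuclideanGeometry.angle (J (r u)) (J (r v)) (J (r w)) =
      InnerProductGeometry.angle (r u - r v) (r w - r v) := by
    intro r u v w
    unfold EuclideanGeometry.angle
    rw [vsub_eq_sub, vsub_eq_sub, ← map_sub, ← map_sub]
    exact J.toLinearIsometry.angle_map _ _
  have hinl : ∀ t, ∃ t', e (Sum.inl t) = Sum.inl t' := fun t => ⟨_, rfl⟩
  have hinr : ∀ s, ∃ s', e (Sum.inr s) = Sum.inr s' := fun s => ⟨_, rfl⟩
  have hsum : ∀ f : τ ⊕ σ → τ ⊕ σ → ℝ, (∑ u, ∑ v, f (e u) (e v)) = ∑ u, ∑ v, f u v := by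
    intro f
    rw [← e.sum_comp]
    exact Finset.sum_congr rfl fun u _ => e.sum_comp (f (e u))
  set P : SteinerVert m → Epc 2 := fun v => J (p (e v)) with hP
  set Q : SteinerVert m → Epc 2 := fun v => J (q (e v)) with hQ
  have hbal' : ∀ x, x ∉ Set.range (Sum.inl : Fin m → SteinerVert m) →
      (∑ v, if T.graph.Adj x v then ‖P x - P v‖⁻¹ • (P x - P v) else 0) = 0 := by
    rintro (t | s) hx
    · simp at hx
    · obtain ⟨s', hs'⟩ := hinr s
      have h1 := congrArg J (hbal s')
      rw [map_sum, map_zero, ← e.sum_comp] at h1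
      refine Eq.trans (Finset.sum_congr rfl fun v _ => ?_) h1
      simp only [hadj, hP, hs', ← map_sub, J.norm_map, apply_ite J, map_smul, map_zero]
  have hkey : ∀ R : SteinerVert m → Epc 2, (∀ t, R (Sum.inl t) = P (Sum.inl t)) →
      treeLength T R - treeLength T P = 1 / 2 * ∑ u, ∑ v, if T.graph.Adj u v then
        dist (R u) (R v) - inner ℝ (R u - R v) (‖P u - P v‖⁻¹ • (P u - P v)) else 0 := by
    intro R hR
    have h1 := sum_inner_eq_sum_dist_of_balanced T.graph _ P R hbal'
      (by rintro _ ⟨t, rfl⟩; exact hR t)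
    unfold treeLength
    rw [← h1, ← mul_sub, ← Finset.sum_sub_distrib]
    congr 1
    refine Finset.sum_congr rfl fun u _ => ?_
    rw [← Finset.sum_sub_distrib]
    refine Finset.sum_congr rfl fun v _ => ?_
    split_ifs <;> simp
  have hle : ∀ R : SteinerVert m → Epc 2, (∀ t, R (Sum.inl t) = P (Sum.inl t)) →
      treeLength T P ≤ treeLength T R := by
    intro R hR
    rw [← sub_nonneg, hkey R hR]
    refine mul_nonneg (by norm_num) (Finset.sum_nonneg fun u _ => Finset.sum_nonneg fun v _ => ?_)
    split_ifs
    · rw [sub_nonneg, dist_eq_norm]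
      refine (real_inner_le_norm _ _).trans (mul_le_of_le_one_right (norm_nonneg _) ?_)
      rw [norm_smul, norm_inv, norm_norm]
      exact inv_mul_le_one
    · rfl
  have hPQ : ∀ t, P (Sum.inl t) = Q (Sum.inl t) := by
    intro t
    obtain ⟨t', ht'⟩ := hinl t
    simp only [hP, hQ, ht', hpq]
  refine ⟨T, Q, P, ?_, hPQ, ?_, ⟨?_, ?_⟩, ?_⟩
  · intro s u v hu hv huv
    obtain ⟨s', hs'⟩ := hinr s
    simp only [hadj, hs'] at hu hv
    simp only [hQ, hangle, hs']
    exact hq s' _ _ hu hv (fun h => huv (e.injective h))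
  · unfold minTreeLength
    symm
    apply IsLeast.csInf_eq
    refine ⟨⟨P, hPQ, rfl⟩, ?_⟩
    rintro L ⟨R, hR, rfl⟩
    exact hle R fun t => (hR t).trans (hPQ t).symm
  · intro u v huv h
    exact hne _ _ huv (J.injective h)
  · intro x u v hu hv huv
    rcases x with t | s
    · exfalso
      obtain ⟨z, hz⟩ := Set.ncard_eq_one.1 (T.degTerminal t)
      have h1 : u ∈ T.graph.neighborSet (Sum.inl t) := hu
      have h2 : v ∈ T.graph.neighborSet (Sum.inl t) := hv
      rw [hz] at h1 h2
      exact huv (h1.trans h2.symm)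
    · obtain ⟨s', hs'⟩ := hinr s
      simp only [hadj, hs'] at hu hv
      simp only [hP, hangle, hs']
      exact (hp s' _ _ hu hv (fun h => huv (e.injective h))).ge
  · have h1 := hkey Q fun t => (hPQ t).symm
    have h2 : treeLength T P = 1 / 2 * ∑ u, ∑ v, if G.Adj u v then dist (p u) (p v) else 0 := by
      unfold treeLength
      rw [← hsum fun u v => if G.Adj u v then dist (p u) (p v) else 0]
      simp only [hadj, hP, J.dist_map]
    have h3 : (∑ u, ∑ v, if T.graph.Adj u v then
        dist (Q u) (Q v) - inner ℝ (Q u - Q v) (‖P u - P v‖⁻¹ • (P u - P v)) else 0) =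
        ∑ u, ∑ v, if G.Adj u v then
        dist (q u) (q v) - inner ℝ (q u - q v) (‖p u - p v‖⁻¹ • (p u - p v)) else 0 := by
      rw [← hsum fun u v => if G.Adj u v then
        dist (q u) (q v) - inner ℝ (q u - q v) (‖p u - p v‖⁻¹ • (p u - p v)) else 0]
      simp only [hadj, hP, hQ, J.dist_map, ← map_sub, J.norm_map, ← map_smul, J.inner_map_map]
    rw [h3] at h1
    rw [h2] at h1 ⊢
    linarith

end Transfer

section Directions

/-- The unit vector with polar angle `x`. -/
def unitDir (x : ℝ) : ℂ := ⟨cos x, sin x⟩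

theorem inner_unitDir (x y : ℝ) : inner ℝ (unitDir x) (unitDir y) = cos (x - y) := by
  simp [unitDir, Complex.inner, Real.cos_sub, mul_comm]

theorem norm_unitDir (x : ℝ) : ‖unitDir x‖ = 1 := by
  have := real_inner_self_eq_norm_sq (unitDir x)
  rw [inner_unitDir, sub_self, cos_zero] at this
  exact (pow_eq_one_iff_of_nonneg (norm_nonneg _) two_ne_zero).1 this.symm

theorem unitDir_add_pi (x : ℝ) : unitDir (x + π) = -unitDir x := by
  apply Complex.ext <;> simp [unitDir]

theorem angle_smul_unitDir {a b : ℝ} (ha : 0 < a) (hb : 0 < b) (x y : ℝ) :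
    InnerProductGeometry.angle (a • unitDir x) (b • unitDir y) = arccos (cos (x - y)) := by
  rw [InnerProductGeometry.angle_smul_left_of_pos _ _ ha,
    InnerProductGeometry.angle_smul_right_of_pos _ _ hb, InnerProductGeometry.angle,
    inner_unitDir, norm_unitDir, norm_unitDir]
  simp

/-- Three directions pairwise form angles within `ε` of `2π/3`. -/
def NearlyEquiangular (ε : ℝ) (x : Fin 3 → ℝ) : Prop :=
  ∀ i j, i ≠ j → |arccos (cos (x i - x j)) - 2 * π / 3| ≤ ε

theorem abs_arccos_cos_sub_le {ε t : ℝ} (hε : ε ≤ 1) (ht : |t - 2 * π / 3| ≤ ε) :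
    |arccos (cos t) - 2 * π / 3| ≤ ε := by
  have h := abs_le.1 ht
  have := pi_gt_three
  rwa [arccos_cos (by linarith) (by linarith)]

theorem nearlyEquiangular_of {ε : ℝ} {x : Fin 3 → ℝ}
    (h01 : |arccos (cos (x 0 - x 1)) - 2 * π / 3| ≤ ε)
    (h02 : |arccos (cos (x 0 - x 2)) - 2 * π / 3| ≤ ε)
    (h12 : |arccos (cos (x 1 - x 2)) - 2 * π / 3| ≤ ε) : NearlyEquiangular ε x := by
  have hc : ∀ a b : ℝ, cos (a - b) = cos (b - a) := fun a b => by rw [← cos_neg, neg_sub]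
  intro i j hij
  fin_cases i <;> fin_cases j <;> first | exact absurd rfl hij | assumption | skip
  all_goals
    simp only [Fin.zero_eta, Fin.mk_one, Fin.reduceFinMk]
    rw [hc]
    assumption

/-- The three edge directions at a vertex whose incoming edge has direction `α`, and whose two
outgoing edges turn by `± π / 3` up to errors `d₁` and `d₂`. -/
theorem nearlyEquiangular_branch {ε α β γ s d₁ d₂ : ℝ} (hε : ε ≤ 1) (hs : s = 1 ∨ s = -1)
    (hβ : β = α + s * (π / 3) + d₁) (hγ : γ = α - s * (π / 3) + d₂)
    (h₁ : |d₁| ≤ ε) (h₂ : |d₂| ≤ ε) (h₁₂ : |d₁ - d₂| ≤ ε) :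
    NearlyEquiangular ε ![α + π, β, γ] := by
  subst hβ hγ
  rw [abs_le] at h₁ h₂ h₁₂
  have hc : ∀ {t u : ℝ}, cos t = cos u → |u - 2 * π / 3| ≤ ε →
      |arccos (cos t) - 2 * π / 3| ≤ ε := fun h hu => by
    rw [h]; exact abs_arccos_cos_sub_le hε hu
  have hp := Real.pi_pos
  apply nearlyEquiangular_of
  · simp only [Matrix.cons_val]
    rcases hs with rfl | rfl
    · refine hc rfl (abs_le.2 ⟨by linarith, by linarith⟩)
    · refine hc (u := 2 * π / 3 + d₁) ?_ (abs_le.2 ⟨by linarith, by linarith⟩)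
      rw [← cos_neg, ← cos_add_two_pi]; congr 1; ring
  · simp only [Matrix.cons_val]
    rcases hs with rfl | rfl
    · refine hc (u := 2 * π / 3 + d₂) ?_ (abs_le.2 ⟨by linarith, by linarith⟩)
      rw [← cos_neg, ← cos_add_two_pi]; congr 1; ring
    · refine hc rfl (abs_le.2 ⟨by linarith, by linarith⟩)
  · simp only [Matrix.cons_val]
    rcases hs with rfl | rfl
    · refine hc rfl (abs_le.2 ⟨by linarith, by linarith⟩)
    · refine hc (cos_neg _).symm (abs_le.2 ⟨by linarith, by linarith⟩)

theorem unitDir_branch_sum {α s : ℝ} (hs : s = 1 ∨ s = -1) :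
    unitDir (α + π) + unitDir (α + s * (π / 3)) + unitDir (α - s * (π / 3)) = 0 := by
  rcases hs with rfl | rfl <;> apply Complex.ext <;>
    simp [unitDir, cos_add, sin_add, cos_sub, sin_sub] <;> ring

end Directions

section Tripod

/-- The vertices of a tripod caterpillar: three arms meet at a central Steiner point, the arm `κ`
carries `n κ` Steiner points, each with one hanging terminal, and ends at a terminal. The terminals
are the three ends and the hanging ones; `inr none` is the centre. -/
abbrev TripodVert (n : Fin 3 → ℕ) :=
  (Fin 3 ⊕ Σ κ, Fin (n κ)) ⊕ Option (Σ κ, Fin (n κ))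

variable (n : Fin 3 → ℕ)

/-- The vertex preceding the `i`-th vertex of the arm `κ`. -/
def tripodBefore (κ : Fin 3) : ℕ → TripodVert n
  | 0 => Sum.inr none
  | i + 1 => if h : i < n κ then Sum.inr (some ⟨κ, i, h⟩) else Sum.inr none

/-- The `i`-th vertex of the arm `κ`. -/
def tripodVertex (κ : Fin 3) (i : ℕ) : TripodVert n :=
  if h : i < n κ then Sum.inr (some ⟨κ, i, h⟩) else Sum.inl (Sum.inl κ)

/-- The parent of a vertex of a tripod rooted at its centre. -/
def tripodParent : TripodVert n → TripodVert n
  | Sum.inl (Sum.inl κ) => tripodBefore n κ (n κ)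
  | Sum.inl (Sum.inr x) => Sum.inr (some x)
  | Sum.inr none => Sum.inr none
  | Sum.inr (some x) => tripodBefore n x.1 x.2

/-- The distance to the centre. -/
def tripodRank : TripodVert n → ℕ
  | Sum.inl (Sum.inl κ) => n κ + 1
  | Sum.inl (Sum.inr x) => x.2 + 2
  | Sum.inr none => 0
  | Sum.inr (some x) => x.2 + 1

theorem tripodRank_before (κ : Fin 3) {i : ℕ} (hi : i ≤ n κ) :
    tripodRank n (tripodBefore n κ i) = i := by
  cases i with
  | zero => rfl
  | succ i => rw [tripodBefore, dif_pos (show i < n κ from hi)]; rfl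

theorem tripodRank_parent_lt (v : TripodVert n) (hv : v ≠ Sum.inr none) :
    tripodRank n (tripodParent n v) < tripodRank n v := by
  rcases v with (κ | ⟨κ, i⟩) | (_ | ⟨κ, i⟩)
  · simp only [tripodParent, tripodRank_before n κ le_rfl]
    simp [tripodRank]
  · simp [tripodParent, tripodRank]
  · exact absurd rfl hv
  · have := tripodRank_before n κ i.2.le
    simp only [tripodParent, this]
    simp [tripodRank]

/-- The graph of the tripod. -/
def tripodGraph : SimpleGraph (TripodVert n) := parentGraph (tripodParent n) (Sum.inr none)

theorem tripodGraph_adj {u v : TripodVert n} : (tripodGraph n).Adj u v ↔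
    (u ≠ Sum.inr none ∧ tripodParent n u = v) ∨ (v ≠ Sum.inr none ∧ tripodParent n v = u) :=
  parentGraph_adj (tripodRank_parent_lt n)

/-- The three neighbours of a Steiner point. -/
def tripodNeighbor : Option (Σ κ, Fin (n κ)) → Fin 3 → TripodVert n
  | none => fun κ => tripodVertex n κ 0
  | some x => ![tripodBefore n x.1 x.2, tripodVertex n x.1 (x.2 + 1), Sum.inl (Sum.inr x)]

theorem tripodBefore_eq_none_iff {κ : Fin 3} {i : ℕ} (hi : i ≤ n κ) :
    tripodBefore n κ i = Sum.inr none ↔ i = 0 := by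
  cases i with
  | zero => simp [tripodBefore]
  | succ i => rw [tripodBefore, dif_pos (show i < n κ from hi)]; simp

theorem tripodBefore_eq_some_iff {κ : Fin 3} {i : ℕ} (hi : i ≤ n κ) (x : Σ κ, Fin (n κ)) :
    tripodBefore n κ i = Sum.inr (some x) ↔ κ = x.1 ∧ i = x.2 + 1 := by
  cases i with
  | zero => simp [tripodBefore]
  | succ i =>
    obtain ⟨κ', j, hj⟩ := x
    rw [tripodBefore, dif_pos (show i < n κ from hi)]
    simp only [Sum.inr.injEq, Option.some.injEq, Sigma.mk.injEq, add_left_inj]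
    constructor
    · rintro ⟨rfl, h⟩
      simpa using h
    · rintro ⟨rfl, rfl⟩
      simp

theorem tripodVertex_of_lt {κ : Fin 3} {i : ℕ} (h : i < n κ) :
    tripodVertex n κ i = Sum.inr (some ⟨κ, i, h⟩) := dif_pos h

theorem tripodVertex_self (κ : Fin 3) : tripodVertex n κ (n κ) = Sum.inl (Sum.inl κ) :=
  dif_neg (lt_irrefl _)

theorem tripodVertex_cases {κ : Fin 3} {i : ℕ} (hi : i ≤ n κ) :
    (∃ h : i < n κ, tripodVertex n κ i = Sum.inr (some ⟨κ, i, h⟩)) ∨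
      (i = n κ ∧ tripodVertex n κ i = Sum.inl (Sum.inl κ)) := by
  rcases hi.lt_or_eq with h | h
  · exact Or.inl ⟨h, tripodVertex_of_lt n h⟩
  · exact Or.inr ⟨h, h ▸ tripodVertex_self n κ⟩

theorem tripodParent_vertex {κ : Fin 3} {i : ℕ} (hi : i ≤ n κ) :
    tripodParent n (tripodVertex n κ i) = tripodBefore n κ i := by
  rcases tripodVertex_cases n hi with ⟨h, h'⟩ | ⟨h, h'⟩
  · rw [h']; rfl
  · rw [h', h]; rfl

theorem tripodVertex_ne_none {κ : Fin 3} {i : ℕ} (hi : i ≤ n κ) :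
    tripodVertex n κ i ≠ Sum.inr none := by
  rcases tripodVertex_cases n hi with ⟨h, h'⟩ | ⟨h, h'⟩ <;> simp [h']

theorem eq_tripodVertex_or_hanging (v : TripodVert n) (hv : v ≠ Sum.inr none) :
    (∃ κ i, i ≤ n κ ∧ v = tripodVertex n κ i) ∨ ∃ x, v = Sum.inl (Sum.inr x) := by
  rcases v with (κ | x) | (_ | ⟨κ, i⟩)
  · exact Or.inl ⟨κ, n κ, le_rfl, (tripodVertex_self n κ).symm⟩
  · exact Or.inr ⟨x, rfl⟩
  · exact absurd rfl hv
  · exact Or.inl ⟨κ, i, i.2.le, (tripodVertex_of_lt n i.2).symm⟩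

theorem tripodGraph_adj_inr_iff (s : Option (Σ κ, Fin (n κ))) (v : TripodVert n) :
    (tripodGraph n).Adj (Sum.inr s) v ↔ ∃ j, v = tripodNeighbor n s j := by
  rw [tripodGraph_adj]
  rcases s with _ | x
  · simp only [ne_eq, not_true_eq_false, false_and, false_or, tripodNeighbor]
    constructor
    · rintro ⟨hv, h⟩
      rcases eq_tripodVertex_or_hanging n v hv with ⟨κ, i, hi, rfl⟩ | ⟨x, rfl⟩
      · rw [tripodParent_vertex n hi, tripodBefore_eq_none_iff n hi] at h
        exact ⟨κ, by rw [h]⟩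
      · simp [tripodParent] at h
    · rintro ⟨κ, rfl⟩
      exact ⟨tripodVertex_ne_none n (Nat.zero_le _), tripodParent_vertex n (Nat.zero_le _)⟩
  · simp only [Fin.exists_fin_succ, tripodNeighbor]
    constructor
    · rintro (⟨-, h⟩ | ⟨hv, h⟩)
      · exact Or.inl h.symm
      · rcases eq_tripodVertex_or_hanging n v hv with ⟨κ, i, hi, rfl⟩ | ⟨y, rfl⟩
        · rw [tripodParent_vertex n hi, tripodBefore_eq_some_iff n hi] at h
          obtain ⟨rfl, rfl⟩ := h
          exact Or.inr (Or.inl rfl)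
        · simp only [tripodParent, Sum.inr.injEq, Option.some.injEq] at h
          subst h
          exact Or.inr (Or.inr (Or.inl rfl))
    · rintro (rfl | rfl | rfl | ⟨j, -⟩)
      · exact Or.inl ⟨by simp, rfl⟩
      · have h := x.2.2
        refine Or.inr ⟨tripodVertex_ne_none n h, ?_⟩
        refine (tripodParent_vertex n h).trans ((tripodBefore_eq_some_iff n h x).2 ⟨rfl, rfl⟩)
      · exact Or.inr ⟨by simp, rfl⟩
      · exact j.elim0

theorem tripodNeighbor_injective (s : Option (Σ κ, Fin (n κ))) :
    Function.Injective (tripodNeighbor n s) := by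
  rcases s with _ | x
  · intro κ κ' h
    simp only [tripodNeighbor] at h
    rcases tripodVertex_cases n (Nat.zero_le (n κ)) with ⟨a, ha⟩ | ⟨a, ha⟩ <;>
    rcases tripodVertex_cases n (Nat.zero_le (n κ')) with ⟨b, hb⟩ | ⟨b, hb⟩ <;>
    rw [ha, hb] at h <;> simp at h
    · exact h.1
    · exact h
  · have h0 := tripodRank_before n x.1 x.2.2.le
    have h1 : tripodRank n (tripodVertex n x.1 (x.2 + 1)) = x.2 + 2 := by
      rcases tripodVertex_cases n x.2.2 with ⟨a, ha⟩ | ⟨a, ha⟩ <;> rw [ha] <;> simp [tripodRank]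
      omega
    have h2 : tripodVertex n x.1 (x.2 + 1) ≠ Sum.inl (Sum.inr x) := by
      rcases tripodVertex_cases n x.2.2 with ⟨a, ha⟩ | ⟨a, ha⟩ <;> rw [ha] <;> simp
    have h3 : tripodBefore n x.1 x.2 ≠ tripodVertex n x.1 (x.2 + 1) := by
      intro h
      rw [h] at h0
      omega
    have h4 : tripodBefore n x.1 x.2 ≠ Sum.inl (Sum.inr x) := by
      intro h
      rw [h] at h0
      simp [tripodRank] at h0
    intro i j hij
    fin_cases i <;> fin_cases j <;> simp [tripodNeighbor] at hij ⊢ <;>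
      first
      | exact h3 hij | exact h4 hij | exact h2 hij
      | exact h3 hij.symm | exact h4 hij.symm | exact h2 hij.symm

end Tripod

/-- A drawing of a tripod in polar form: the position of the centre, and the length and direction
of every edge, for the edges along the arms and for those to the hanging terminals. -/
structure TripodDrawing where
  /-- the position of the centre -/
  center : ℂ
  /-- the length of the `i`-th edge of an arm -/
  len : Fin 3 → ℕ → ℝ
  /-- the direction of the `i`-th edge of an arm -/
  dir : Fin 3 → ℕ → ℝ
  /-- the length of the edge to the `i`-th hanging terminal of an arm -/
  hangLen : Fin 3 → ℕ → ℝ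
  /-- the direction of the edge to the `i`-th hanging terminal of an arm -/
  hangDir : Fin 3 → ℕ → ℝ

namespace TripodDrawing

variable (D : TripodDrawing) (n : Fin 3 → ℕ)

/-- The position of the end of the first `i` edges of the arm `κ`. -/
def spine (κ : Fin 3) (i : ℕ) : ℂ :=
  D.center + ∑ l ∈ Finset.range i, D.len κ l • unitDir (D.dir κ l)

theorem spine_succ (κ : Fin 3) (i : ℕ) :
    D.spine κ (i + 1) = D.spine κ i + D.len κ i • unitDir (D.dir κ i) := by
  rw [spine, spine, Finset.sum_range_succ, add_assoc]

/-- The positions of the vertices. -/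
def pos : TripodVert n → ℂ
  | Sum.inl (Sum.inl κ) => D.spine κ (n κ + 1)
  | Sum.inl (Sum.inr x) =>
    D.spine x.1 (x.2 + 1) + D.hangLen x.1 x.2 • unitDir (D.hangDir x.1 x.2)
  | Sum.inr none => D.center
  | Sum.inr (some x) => D.spine x.1 (x.2 + 1)

/-- The length of the edge to the parent. -/
def edgeLen : TripodVert n → ℝ
  | Sum.inl (Sum.inl κ) => D.len κ (n κ)
  | Sum.inl (Sum.inr x) => D.hangLen x.1 x.2
  | Sum.inr none => 0
  | Sum.inr (some x) => D.len x.1 x.2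

/-- The direction of the edge from the parent. -/
def edgeDir : TripodVert n → ℝ
  | Sum.inl (Sum.inl κ) => D.dir κ (n κ)
  | Sum.inl (Sum.inr x) => D.hangDir x.1 x.2
  | Sum.inr none => 0
  | Sum.inr (some x) => D.dir x.1 x.2

/-- The lengths of the three edges at a Steiner point. -/
def nbrLen : Option (Σ κ, Fin (n κ)) → Fin 3 → ℝ
  | none => fun κ => D.len κ 0
  | some x => ![D.len x.1 x.2, D.len x.1 (x.2 + 1), D.hangLen x.1 x.2]

/-- The outward directions of the three edges at a Steiner point. -/
def nbrDir : Option (Σ κ, Fin (n κ)) → Fin 3 → ℝ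
  | none => fun κ => D.dir κ 0
  | some x => ![D.dir x.1 x.2 + π, D.dir x.1 (x.2 + 1), D.hangDir x.1 x.2]

/-- All edges that occur have positive length. -/
def Nondegenerate : Prop :=
  (∀ κ, ∀ i ≤ n κ, 0 < D.len κ i) ∧ ∀ κ, ∀ i < n κ, 0 < D.hangLen κ i

theorem pos_before {κ : Fin 3} {i : ℕ} (hi : i ≤ n κ) :
    D.pos n (tripodBefore n κ i) = D.spine κ i := by
  cases i with
  | zero => simp [tripodBefore, pos, spine]
  | succ i => rw [tripodBefore, dif_pos (show i < n κ from hi)]; rfl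

theorem pos_vertex {κ : Fin 3} {i : ℕ} (hi : i ≤ n κ) :
    D.pos n (tripodVertex n κ i) = D.spine κ (i + 1) := by
  rcases tripodVertex_cases n hi with ⟨h, h'⟩ | ⟨h, h'⟩
  · rw [h']; rfl
  · rw [h', h]; rfl

theorem pos_sub_parent (v : TripodVert n) (hv : v ≠ Sum.inr none) :
    D.pos n v - D.pos n (tripodParent n v) = D.edgeLen n v • unitDir (D.edgeDir n v) := by
  rcases v with (κ | x) | (_ | x)
  · rw [tripodParent, pos_before _ _ le_rfl, pos, spine_succ]; simp [edgeLen, edgeDir]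
  · simp [tripodParent, pos, edgeLen, edgeDir]
  · exact absurd rfl hv
  · rw [tripodParent, pos_before _ _ x.2.2.le, pos, spine_succ]; simp [edgeLen, edgeDir]

theorem pos_neighbor_sub (s : Option (Σ κ, Fin (n κ))) (j : Fin 3) :
    D.pos n (tripodNeighbor n s j) - D.pos n (Sum.inr s) =
      D.nbrLen n s j • unitDir (D.nbrDir n s j) := by
  rcases s with _ | x
  · simp only [tripodNeighbor, nbrLen, nbrDir]
    rw [pos_vertex _ _ (Nat.zero_le _), spine_succ]
    simp [spine, pos]
  · fin_cases j
    · change D.pos n (tripodBefore n x.1 x.2) - D.spine x.1 (x.2 + 1) =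
        D.len x.1 x.2 • unitDir (D.dir x.1 x.2 + π)
      rw [pos_before _ _ x.2.2.le, spine_succ, unitDir_add_pi]
      simp
    · change D.pos n (tripodVertex n x.1 (x.2 + 1)) - D.spine x.1 (x.2 + 1) =
        D.len x.1 (x.2 + 1) • unitDir (D.dir x.1 (x.2 + 1))
      rw [pos_vertex _ _ x.2.2, spine_succ]
      simp
    · change D.spine x.1 (x.2 + 1) + _ - D.spine x.1 (x.2 + 1) =
        D.hangLen x.1 x.2 • unitDir (D.hangDir x.1 x.2)
      simp

variable {D n}

theorem Nondegenerate.nbrLen_pos (h : D.Nondegenerate n) (s : Option (Σ κ, Fin (n κ)))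
    (j : Fin 3) : 0 < D.nbrLen n s j := by
  rcases s with _ | x
  · exact h.1 _ _ (Nat.zero_le _)
  · fin_cases j
    · exact h.1 _ _ x.2.2.le
    · exact h.1 _ _ x.2.2
    · exact h.2 _ _ x.2.2

theorem Nondegenerate.edgeLen_pos (h : D.Nondegenerate n) (v : TripodVert n)
    (hv : v ≠ Sum.inr none) : 0 < D.edgeLen n v := by
  rcases v with (κ | x) | (_ | x)
  · exact h.1 _ _ le_rfl
  · exact h.2 _ _ x.2.2
  · exact absurd rfl hv
  · exact h.1 _ _ x.2.2.le

theorem Nondegenerate.dist_parent (h : D.Nondegenerate n) (v : TripodVert n)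
    (hv : v ≠ Sum.inr none) : dist (D.pos n v) (D.pos n (tripodParent n v)) = D.edgeLen n v := by
  rw [dist_eq_norm, pos_sub_parent _ _ _ hv, norm_smul, norm_unitDir, mul_one, Real.norm_eq_abs,
    abs_of_pos (h.edgeLen_pos v hv)]

theorem Nondegenerate.normalized_edge (h : D.Nondegenerate n) (v : TripodVert n)
    (hv : v ≠ Sum.inr none) :
    ‖D.pos n v - D.pos n (tripodParent n v)‖⁻¹ • (D.pos n v - D.pos n (tripodParent n v)) =
      unitDir (D.edgeDir n v) := by
  rw [← dist_eq_norm, h.dist_parent v hv, pos_sub_parent _ _ _ hv, smul_smul,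
    inv_mul_cancel₀ (h.edgeLen_pos v hv).ne', one_smul]

theorem Nondegenerate.pos_ne (h : D.Nondegenerate n) {u v : TripodVert n}
    (huv : (tripodGraph n).Adj u v) : D.pos n u ≠ D.pos n v := by
  have key : ∀ w, w ≠ Sum.inr none → D.pos n w ≠ D.pos n (tripodParent n w) := by
    intro w hw
    rw [← dist_pos, h.dist_parent w hw]
    exact h.edgeLen_pos w hw
  rcases (tripodGraph_adj n).1 huv with ⟨hu, rfl⟩ | ⟨hv, rfl⟩
  · exact key _ hu
  · exact (key _ hv).symm

theorem Nondegenerate.abs_angle_sub_le (h : D.Nondegenerate n) {ε : ℝ}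
    {s : Option (Σ κ, Fin (n κ))} (hs : NearlyEquiangular ε (D.nbrDir n s)) {u v : TripodVert n}
    (hu : (tripodGraph n).Adj (Sum.inr s) u) (hv : (tripodGraph n).Adj (Sum.inr s) v)
    (huv : u ≠ v) :
    |InnerProductGeometry.angle (D.pos n u - D.pos n (Sum.inr s))
      (D.pos n v - D.pos n (Sum.inr s)) - 2 * π / 3| ≤ ε := by
  obtain ⟨i, rfl⟩ := (tripodGraph_adj_inr_iff n s u).1 hu
  obtain ⟨j, rfl⟩ := (tripodGraph_adj_inr_iff n s v).1 hv
  rw [pos_neighbor_sub, pos_neighbor_sub, angle_smul_unitDir (h.nbrLen_pos s i) (h.nbrLen_pos s j)]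
  exact hs i j fun hij => huv (by rw [hij])

open Classical in
theorem Nondegenerate.balanced (h : D.Nondegenerate n) {s : Option (Σ κ, Fin (n κ))}
    (hs : ∑ j, unitDir (D.nbrDir n s j) = 0) :
    (∑ v, if (tripodGraph n).Adj (Sum.inr s) v then ‖D.pos n (Sum.inr s) - D.pos n v‖⁻¹ •
      (D.pos n (Sum.inr s) - D.pos n v) else 0) = 0 := by
  rw [← Finset.sum_filter]
  have : Finset.univ.filter (fun v => (tripodGraph n).Adj (Sum.inr s) v) =
      Finset.univ.image (tripodNeighbor n s) := by
    ext v
    simp [tripodGraph_adj_inr_iff, eq_comm]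
  rw [this, Finset.sum_image fun a _ b _ hab => tripodNeighbor_injective n s hab]
  rw [← neg_eq_zero, ← Finset.sum_neg_distrib, ← hs]
  refine Finset.sum_congr rfl fun j _ => ?_
  rw [← smul_neg, neg_sub, norm_sub_rev, pos_neighbor_sub, norm_smul, norm_unitDir, mul_one,
    Real.norm_eq_abs, abs_of_pos (h.nbrLen_pos s j), smul_smul,
    inv_mul_cancel₀ (h.nbrLen_pos s j).ne', one_smul]

theorem sum_tripodVert (f : TripodVert n → ℝ) : ∑ v, f v = f (Sum.inr none) + ∑ κ,
    (f (Sum.inl (Sum.inl κ)) +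
      ∑ i : Fin (n κ), (f (Sum.inr (some ⟨κ, i⟩)) + f (Sum.inl (Sum.inr ⟨κ, i⟩)))) := by
  simp only [Fintype.sum_sum_type, Fintype.sum_option, Fintype.sum_sigma, Finset.sum_add_distrib]
  ring

end TripodDrawing

open TripodDrawing in
/-- An exact drawing `S` and an approximate drawing `T` of a tripod with the same terminals give a
full approximate Steiner tree whose shortest tree is locally minimum; the relative error is
estimated by the rotation of the last edges of the three arms. -/
theorem exists_steiner_tree_of_tripod {n : Fin 3 → ℕ} {m : ℕ} (hm : m = 3 + ∑ κ, n κ)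
    (S T : TripodDrawing) (hS : S.Nondegenerate n) (hT : T.Nondegenerate n) {ε C : ℝ}
    (hSe : ∀ s, NearlyEquiangular 0 (S.nbrDir n s))
    (hSb : ∀ s, ∑ j, unitDir (S.nbrDir n s j) = 0)
    (hTe : ∀ s, NearlyEquiangular ε (T.nbrDir n s))
    (hST : ∀ t, S.pos n (Sum.inl t) = T.pos n (Sum.inl t))
    (hgap : C * (∑ κ, (S.len κ (n κ) + ∑ i : Fin (n κ), (S.len κ i + S.hangLen κ i))) <
      ∑ κ, T.len κ (n κ) * (1 - cos (T.dir κ (n κ) - S.dir κ (n κ)))) :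
    ∃ (G : FullSteinerTopology m) (pos pos' : SteinerVert m → Epc 2),
      IsApproxSteiner ε G pos ∧
      (∀ t : Fin m, pos' (Sum.inl t) = pos (Sum.inl t)) ∧
      treeLength G pos' = minTreeLength G pos ∧
      IsLocallyMinimumTree G pos' ∧
      treeLength G pos > (1 + C) * treeLength G pos' := by
  classical
  refine exists_steiner_tree_of_drawing (by simp [hm]) (by simp [hm]; omega) (tripodGraph n)
    (parentGraph_isTree (tripodRank_parent_lt n)) ?_ ?_ (S.pos n) (T.pos n) ε C
    (fun s u v hu hv huv => hT.abs_angle_sub_le (hTe s) hu hv huv)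
    (fun s u v hu hv huv => by
      have := hS.abs_angle_sub_le (hSe s) hu hv huv
      exact sub_eq_zero.1 (abs_nonpos_iff.1 this))
    (fun u v huv => hS.pos_ne huv) (fun s => ?_) hST ?_
  · intro t
    rw [Set.ncard_eq_one]
    refine ⟨tripodParent n (Sum.inl t), Set.ext fun v => ?_⟩
    rw [SimpleGraph.mem_neighborSet, tripodGraph_adj, Set.mem_singleton_iff]
    constructor
    · rintro (⟨-, h⟩ | ⟨hv, h⟩)
      · exact h.symm
      · exfalso
        rcases eq_tripodVertex_or_hanging n v hv with ⟨κ, i, hi, rfl⟩ | ⟨x, rfl⟩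
        · rw [tripodParent_vertex n hi] at h
          cases i with
          | zero => simp [tripodBefore] at h
          | succ i =>
            rw [tripodBefore, dif_pos (show i < n κ from hi)] at h
            simp at h
        · simp [tripodParent] at h
    · rintro rfl
      exact Or.inl ⟨by simp, rfl⟩
  · intro s
    have : (tripodGraph n).neighborSet (Sum.inr s) = Set.range (tripodNeighbor n s) := by
      ext v
      simp [tripodGraph_adj_inr_iff, eq_comm]
    rw [this, ← Set.image_univ, Set.ncard_image_of_injective _ (tripodNeighbor_injective n s)]
    simp
  · convert hS.balanced (hSb s)
  · have e1 := sum_parentGraph_adj (tripodRank_parent_lt n)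
      (f := fun u v => dist (S.pos n u) (S.pos n v)) (fun u v => dist_comm _ _)
      (g := S.edgeLen n) rfl hS.dist_parent
    have e2 := sum_parentGraph_adj (tripodRank_parent_lt n)
      (f := fun u v => dist (T.pos n u) (T.pos n v) - inner ℝ (T.pos n u - T.pos n v)
        (‖S.pos n u - S.pos n v‖⁻¹ • (S.pos n u - S.pos n v)))
      (fun u v => by
        rw [dist_comm, norm_sub_rev (S.pos n u), ← neg_sub (T.pos n v), ← neg_sub (S.pos n v),
          smul_neg, inner_neg_neg])
      (g := fun v => T.edgeLen n v * (1 - cos (T.edgeDir n v - S.edgeDir n v)))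
      (by simp [edgeLen]) (fun v hv => by
        rw [hT.dist_parent v hv, hS.normalized_edge v hv, pos_sub_parent _ _ _ hv, inner_smul_left,
          inner_unitDir]
        simp
        ring)
    have e5 : ∀ v, 0 ≤ T.edgeLen n v * (1 - cos (T.edgeDir n v - S.edgeDir n v)) := by
      intro v
      by_cases hv : v = Sum.inr none
      · rw [hv]; simp [edgeLen]
      · exact mul_nonneg (hT.edgeLen_pos v hv).le (sub_nonneg.2 (cos_le_one _))
    unfold tripodGraph
    rw [e1, e2, sum_tripodVert, sum_tripodVert]
    have e6 : ∀ κ, T.len κ (n κ) * (1 - cos (T.dir κ (n κ) - S.dir κ (n κ))) ≤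
        T.edgeLen n (Sum.inl (Sum.inl κ)) * (1 - cos (T.edgeDir n (Sum.inl (Sum.inl κ)) -
          S.edgeDir n (Sum.inl (Sum.inl κ)))) + ∑ i : Fin (n κ),
        (T.edgeLen n (Sum.inr (some ⟨κ, i⟩)) * (1 - cos (T.edgeDir n (Sum.inr (some ⟨κ, i⟩)) -
          S.edgeDir n (Sum.inr (some ⟨κ, i⟩)))) +
        T.edgeLen n (Sum.inl (Sum.inr ⟨κ, i⟩)) * (1 - cos (T.edgeDir n (Sum.inl (Sum.inr ⟨κ, i⟩)) -
          S.edgeDir n (Sum.inl (Sum.inr ⟨κ, i⟩))))) := fun κ =>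
      le_add_of_nonneg_right (Finset.sum_nonneg fun i _ => add_nonneg (e5 _) (e5 _))
    have e7 := hgap.trans_le (Finset.sum_le_sum fun κ (_ : κ ∈ Finset.univ) => e6 κ)
    have e8 := e5 (Sum.inr none)
    simp only [edgeLen, zero_add, zero_mul] at e7 e8 ⊢
    linarith

section Displacement

/-- The length of the edge of direction `α - ψ` that differs by `d` from an edge of
direction `α`. -/
def turnedLen (α ψ : ℝ) (d : ℂ) : ℝ := (d.re * sin α - d.im * cos α) / sin ψ

/-- The length of the edge of direction `α` that differs by `-d` from an edge of
direction `α - ψ`. -/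
def unturnedLen (α ψ : ℝ) (d : ℂ) : ℝ := (d.re * sin (α - ψ) - d.im * cos (α - ψ)) / sin ψ

theorem turnedLen_smul_unitDir {α ψ : ℝ} (h : sin ψ ≠ 0) (d : ℂ) :
    turnedLen α ψ d • unitDir (α - ψ) = unturnedLen α ψ d • unitDir α + d := by
  have h1 := sin_sq_add_cos_sq α
  apply Complex.ext
  · simp only [turnedLen, unturnedLen, unitDir, Complex.smul_re, Complex.add_re, smul_eq_mul,
      cos_sub, sin_sub]
    field_simp
    linear_combination d.re * sin ψ * h1
  · simp only [turnedLen, unturnedLen, unitDir, Complex.smul_im, Complex.add_im, smul_eq_mul,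
      cos_sub, sin_sub]
    field_simp
    linear_combination d.im * sin ψ * h1

/-- The reflection of the plane in the imaginary axis. -/
def reflectIm (z : ℂ) : ℂ := ⟨-z.re, z.im⟩

theorem turnedLen_smul_unitDir_reflect {α ψ : ℝ} (h : sin ψ ≠ 0) (d : ℂ) :
    turnedLen α ψ d • unitDir (π - (α - ψ)) =
      unturnedLen α ψ d • unitDir (π - α) + reflectIm d := by
  have h1 := turnedLen_smul_unitDir (α := α) h d
  have hre := congrArg Complex.re h1
  have him := congrArg Complex.im h1
  simp only [unitDir, Complex.smul_re, Complex.add_re, Complex.smul_im, Complex.add_im,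
    smul_eq_mul] at hre him
  apply Complex.ext
  · simp only [unitDir, reflectIm, Complex.smul_re, Complex.add_re, smul_eq_mul, cos_pi_sub]
    linarith
  · simp only [unitDir, reflectIm, Complex.smul_im, Complex.add_im, smul_eq_mul, sin_pi_sub]
    linarith

theorem sqrt_three_div_two_bounds : 0.866 < √3 / 2 ∧ √3 / 2 < 0.8661 := by
  constructor
  · have : (1.732 : ℝ) < √3 := Real.lt_sqrt_of_sq_lt (by norm_num)
    linarith
  · have : √3 < 1.7322 := (Real.sqrt_lt' (by norm_num)).2 (by norm_num)
    linarith

variable {s ψ : ℝ} {d : ℂ}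

theorem lt_turnedLen_mul_sin (hs : s = 1 ∨ s = -1) (hψ : sin ψ ≠ 0) (hd : d.im < 0) :
    -d.im * 0.866 + s * d.re / 2 < turnedLen (s * (π / 6)) ψ d * sin ψ := by
  have h := sqrt_three_div_two_bounds.1
  rw [turnedLen, div_mul_cancel₀ _ hψ]
  rcases hs with rfl | rfl
  · rw [one_mul, one_mul, sin_pi_div_six, cos_pi_div_six]
    nlinarith
  · rw [neg_one_mul, neg_one_mul, sin_neg, cos_neg, sin_pi_div_six, cos_pi_div_six]
    nlinarith

theorem unturnedLen_mul_sin_bounds (hs : s = 1 ∨ s = -1) (hψ : 0 < ψ) (hd : d.im < 0)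
    (h0 : s * d.re ≤ 0) (h : ψ ≤ 1 / 8 ∧ 11 / 10 * d.im ≤ s * d.re ∨
      ψ ≤ 1 / 2 ∧ 1 / 5 * d.im ≤ s * d.re) :
    0 < unturnedLen (s * (π / 6)) ψ d * sin ψ ∧
      unturnedLen (s * (π / 6)) ψ d * sin ψ ≤ -d.im := by
  have hψ2 : ψ ≤ 1 / 2 := by rcases h with h | h <;> linarith
  have hsin : 0 < sin ψ := sin_pos_of_pos_of_lt_pi hψ (by linarith [pi_gt_three])
  have hsin' : sin ψ ≤ ψ := sin_le hψ.le
  have hcos := one_sub_sq_div_two_le_cos (x := ψ)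
  have hcos1 := cos_le_one ψ
  obtain ⟨r1, r2⟩ := sqrt_three_div_two_bounds
  have hnum : unturnedLen (s * (π / 6)) ψ d * sin ψ =
      -d.im * (√3 / 2 * cos ψ + s * (1 / 2 * sin ψ)) +
        s * d.re * (1 / 2 * cos ψ - s * (√3 / 2 * sin ψ)) := by
    rw [unturnedLen, div_mul_cancel₀ _ hsin.ne']
    rcases hs with rfl | rfl <;>
      simp only [one_mul, neg_one_mul, sin_sub, cos_sub, sin_neg, cos_neg, sin_pi_div_six,
        cos_pi_div_six] <;> ring
  have hle : √3 / 2 * cos ψ + s * (1 / 2 * sin ψ) ≤ 1 := by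
    have : √3 / 2 * cos ψ + s * (1 / 2 * sin ψ) = cos (π / 6 - s * ψ) := by
      rw [cos_sub, sin_pi_div_six, cos_pi_div_six]
      rcases hs with rfl | rfl <;> simp
    rw [this]
    exact cos_le_one _
  have hc : 0.875 ≤ cos ψ := by nlinarith
  have hs1 : -1 ≤ s ∧ s ≤ 1 := by rcases hs with rfl | rfl <;> norm_num
  have hge : 0 ≤ 1 / 2 * cos ψ - s * (√3 / 2 * sin ψ) := by
    have : s * (√3 / 2 * sin ψ) ≤ √3 / 2 * sin ψ :=
      mul_le_of_le_one_left (by positivity) hs1.2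
    nlinarith
  rw [hnum]
  refine ⟨?_, by nlinarith⟩
  have k1 : -(1 / 2 * sin ψ) ≤ s * (1 / 2 * sin ψ) := by nlinarith
  have k2 : -(√3 / 2 * sin ψ) ≤ s * (√3 / 2 * sin ψ) := by
    have : 0 ≤ √3 / 2 * sin ψ := by positivity
    nlinarith
  have hP : 0.866 * cos ψ - sin ψ / 2 ≤ √3 / 2 * cos ψ + s * (1 / 2 * sin ψ) := by nlinarith
  have hQ : 1 / 2 * cos ψ - s * (√3 / 2 * sin ψ) ≤ cos ψ / 2 + 0.8661 * sin ψ := by nlinarith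
  set P := √3 / 2 * cos ψ + s * (1 / 2 * sin ψ)
  set Q := 1 / 2 * cos ψ - s * (√3 / 2 * sin ψ)
  rcases h with ⟨h1, h2⟩ | ⟨h1, h2⟩
  · have hc' : 0.99 ≤ cos ψ := by nlinarith
    have hP' : 0.79 ≤ P := by linarith
    have hQ' : Q ≤ 0.61 := by linarith
    nlinarith
  · have hP' : 0.5 ≤ P := by linarith
    have hQ' : Q ≤ 1 := by linarith
    nlinarith

end Displacement

section Zigzag

/-- The alternating sign. -/
def altSign (j : ℕ) : ℝ := (-1) ^ j

theorem altSign_zero : altSign 0 = 1 := pow_zero _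

theorem altSign_succ (j : ℕ) : altSign (j + 1) = -altSign j := by simp [altSign, pow_succ]

theorem altSign_eq (j : ℕ) : altSign j = 1 ∨ altSign j = -1 := neg_one_pow_eq_or ℝ j

/-- The drawing of a tripod whose arms zigzag by `± π / 3`, with the `j`-th edge of the arm `κ` and
the `j`-th hanging edge rotated by `ψ κ j`, clockwise on the arms `0` and `1` and counterclockwise
on the arm `2`. -/
def zigzag (c : ℂ) (len hangLen ψ : Fin 3 → ℕ → ℝ) : TripodDrawing where
  center := c
  len := len
  dir κ j := ![-(2 * π / 3), 0, π] κ + ![1, 1, -1] κ * (altSign j * (π / 6) - ψ κ j)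
  hangLen := hangLen
  hangDir κ j := ![-(2 * π / 3), 0, π] κ + ![1, 1, -1] κ * (altSign j * (π / 2) - ψ κ j)

theorem zigzag_nearlyEquiangular (c : ℂ) (len hangLen : Fin 3 → ℕ → ℝ) {ψ : Fin 3 → ℕ → ℝ}
    (n : Fin 3 → ℕ) {ε : ℝ} (hε : ε ≤ 1) (hψ : ∀ κ j, |ψ κ (j + 1) - ψ κ j| ≤ ε)
    (h0 : ψ 0 0 = 0) (h1 : |2 * ψ 1 0| ≤ ε) (h2 : ψ 2 0 = ψ 1 0)
    (s : Option (Σ κ, Fin (n κ))) :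
    NearlyEquiangular ε ((zigzag c len hangLen ψ).nbrDir n s) := by
  have hε0 : 0 ≤ ε := (abs_nonneg _).trans h1
  have h1' := abs_le.1 h1
  rcases s with _ | ⟨κ, j⟩
  · have hc : ∀ {t u : ℝ}, cos t = cos u → |u - 2 * π / 3| ≤ ε →
        |arccos (cos t) - 2 * π / 3| ≤ ε := fun h hu => by
      rw [h]; exact abs_arccos_cos_sub_le hε hu
    apply nearlyEquiangular_of
    · refine hc (u := 2 * π / 3 - ψ 1 0) ?_ (abs_le.2 ⟨by linarith, by linarith⟩)
      rw [← cos_neg]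
      congr 1
      simp [TripodDrawing.nbrDir, zigzag, h0, altSign_zero]
      ring
    · refine hc (u := 2 * π / 3 - ψ 1 0) ?_ (abs_le.2 ⟨by linarith, by linarith⟩)
      rw [← cos_add_two_pi]
      congr 1
      simp [TripodDrawing.nbrDir, zigzag, h0, h2, altSign_zero]
      ring
    · refine hc (u := 2 * π / 3 + 2 * ψ 1 0) ?_ (abs_le.2 ⟨by linarith, by linarith⟩)
      rw [← cos_neg]
      congr 1
      simp [TripodDrawing.nbrDir, zigzag, h2, altSign_zero]
      ring
  · have hg : (![1, 1, -1] : Fin 3 → ℝ) κ = 1 ∨ (![1, 1, -1] : Fin 3 → ℝ) κ = -1 := by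
      fin_cases κ <;> simp
    refine nearlyEquiangular_branch (s := -(![1, 1, -1] : Fin 3 → ℝ) κ * altSign j)
      (d₁ := -(![1, 1, -1] : Fin 3 → ℝ) κ * (ψ κ (j + 1) - ψ κ j)) (d₂ := 0) hε ?_ ?_ ?_ ?_ ?_ ?_
    · rcases hg with hg | hg <;> rcases altSign_eq j with h | h <;> rw [hg, h] <;> norm_num
    · simp only [zigzag, altSign_succ]
      ring
    · simp only [zigzag]
      ring
    · have := hψ κ j
      rcases hg with hg | hg <;> rw [hg] <;> simpa [abs_sub_comm] using this
    · simpa using hε0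
    · have := hψ κ j
      rcases hg with hg | hg <;> rw [hg] <;> simpa [abs_sub_comm] using this

theorem sum_unitDir_zigzag (c : ℂ) (len hangLen : Fin 3 → ℕ → ℝ) (n : Fin 3 → ℕ)
    (s : Option (Σ κ, Fin (n κ))) :
    ∑ j, unitDir ((zigzag c len hangLen 0).nbrDir n s j) = 0 := by
  rw [Fin.sum_univ_three]
  rcases s with _ | ⟨κ, j⟩
  · have e0 : -(2 * π / 3) + 1 * (altSign 0 * (π / 6) - 0) = -(π / 2) := by
      rw [altSign_zero]; ring
    have e1 : 0 + 1 * (altSign 0 * (π / 6) - 0) = π / 6 := by rw [altSign_zero]; ring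
    have e2 : π + -1 * (altSign 0 * (π / 6) - 0) = π - π / 6 := by rw [altSign_zero]; ring
    simp only [TripodDrawing.nbrDir, zigzag, Pi.zero_apply, Matrix.cons_val, e0, e1, e2]
    apply Complex.ext <;> simp [unitDir]
    norm_num
  · have hg : (![1, 1, -1] : Fin 3 → ℝ) κ = 1 ∨ (![1, 1, -1] : Fin 3 → ℝ) κ = -1 := by
      fin_cases κ <;> simp
    have h := unitDir_branch_sum (α := (zigzag c len hangLen 0).dir κ j)
      (s := -(![1, 1, -1] : Fin 3 → ℝ) κ * altSign j)
      (by rcases hg with hg | hg <;> rcases altSign_eq j with h | h <;> rw [hg, h] <;> norm_num)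
    rw [← h]
    simp only [TripodDrawing.nbrDir, Matrix.cons_val]
    congr 3
    · simp only [zigzag, altSign_succ, Pi.zero_apply]
      ring
    · simp only [zigzag, Pi.zero_apply]
      ring

end Zigzag

section Bend

variable (ε : ℝ) (q : ℕ)

/-- The rotation of the `j`-th edges of a bent arm. -/
def bend (j : ℕ) : ℝ := (j + 1 / 2) * ε

/-- The horizontal displacement of the `i`-th vertex of a bent arm. -/
def lateralShift : ℕ → ℝ
  | 0 => 0
  | j + 1 => (1 / 2 - 11 / 20 * altSign j) * bend ε j

/-- The displacement of the `i`-th vertex of a bent arm; the last vertex is fixed. -/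
def vertexShift (i : ℕ) : ℂ := if i ≤ q then ⟨lateralShift ε i, 1 - ε * i ^ 2 / 2⟩ else 0

/-- The change of the `j`-th edge of a bent arm. -/
def edgeShift (j : ℕ) : ℂ := vertexShift ε q (j + 1) - vertexShift ε q j

/-- The lengths of the edges of a straight arm. -/
def straightLen (j : ℕ) : ℝ := unturnedLen (altSign j * (π / 6)) (bend ε j) (edgeShift ε q j)

/-- The lengths of the edges of a bent arm. -/
def bentLen (j : ℕ) : ℝ := turnedLen (altSign j * (π / 6)) (bend ε j) (edgeShift ε q j)

/-- The lengths of the hanging edges of a straight arm. -/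
def straightHangLen (j : ℕ) : ℝ :=
  unturnedLen (altSign j * (π / 2)) (bend ε j) (-vertexShift ε q (j + 1))

/-- The lengths of the hanging edges of a bent arm. -/
def bentHangLen (j : ℕ) : ℝ :=
  turnedLen (altSign j * (π / 2)) (bend ε j) (-vertexShift ε q (j + 1))

variable {ε q}

theorem altSign_mul_lateralShift_succ (j : ℕ) :
    altSign j * lateralShift ε (j + 1) = (altSign j / 2 - 11 / 20) * bend ε j := by
  rw [lateralShift]
  rcases altSign_eq j with h | h <;> rw [h] <;> ring

theorem bend_le_eighth (hε : 0 < ε) (hq : ε * q ^ 2 ≤ 1 / 4) {j : ℕ} (hj : j < q) :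
    bend ε j ≤ 1 / 8 := by
  have h : (j : ℝ) + 1 ≤ q := by exact_mod_cast hj
  rw [bend]
  nlinarith [sq_nonneg ((q : ℝ) - 1)]

theorem bend_le_half (hε : 0 < ε) (hε1 : ε ≤ 1) (hq : ε * q ^ 2 ≤ 1 / 4) : bend ε q ≤ 1 / 2 := by
  rw [bend]
  rcases Nat.eq_zero_or_pos q with rfl | h
  · norm_num
    exact hε1
  · have h : (1 : ℝ) ≤ q := by exact_mod_cast h
    have h1 : ε * q ≤ ε * q ^ 2 := mul_le_mul_of_nonneg_left (by nlinarith) hε.le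
    have h2 : ε * 1 ≤ ε * q := mul_le_mul_of_nonneg_left h hε.le
    linarith

theorem bend_pos (hε : 0 < ε) (j : ℕ) : 0 < bend ε j := by rw [bend]; positivity

theorem sin_bend_pos (hε : 0 < ε) (hε1 : ε ≤ 1) (hq : ε * q ^ 2 ≤ 1 / 4) {j : ℕ} (hj : j ≤ q) :
    0 < sin (bend ε j) := by
  refine sin_pos_of_pos_of_lt_pi (bend_pos hε j) ?_
  have h1 : bend ε j ≤ bend ε q := by
    have : (j : ℝ) ≤ q := by exact_mod_cast hj
    unfold bend
    gcongr
  linarith [bend_le_half hε hε1 hq, pi_gt_three]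

theorem edgeShift_im_of_lt {j : ℕ} (hj : j < q) : (edgeShift ε q j).im = -bend ε j := by
  rw [edgeShift, vertexShift, vertexShift, if_pos hj.le, if_pos (show j + 1 ≤ q from hj), bend]
  simp only [Complex.sub_im]
  push_cast
  ring

theorem altSign_mul_edgeShift_re_of_lt (hε : 0 < ε) {j : ℕ} (hj : j < q) :
    altSign j * (edgeShift ε q j).re ≤ 0 ∧
      -(11 / 10 * bend ε j) ≤ altSign j * (edgeShift ε q j).re := by
  have hre : (edgeShift ε q j).re = lateralShift ε (j + 1) - lateralShift ε j := by
    rw [edgeShift, vertexShift, vertexShift, if_pos hj.le, if_pos (show j + 1 ≤ q from hj)]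
    rfl
  rw [hre, mul_sub, altSign_mul_lateralShift_succ]
  have hb := bend_pos hε j
  cases j with
  | zero =>
    rw [altSign_zero, lateralShift]
    constructor <;> linarith
  | succ i =>
    have hi := bend_pos hε i
    have hle : bend ε i ≤ bend ε (i + 1) := by
      unfold bend
      push_cast
      nlinarith
    rw [altSign_succ, neg_mul (altSign i), altSign_mul_lateralShift_succ]
    rcases altSign_eq i with h | h <;> rw [h] <;> constructor <;> linarith

theorem edgeShift_im_self : (edgeShift ε q q).im = -(1 - ε * q ^ 2 / 2) := by
  rw [edgeShift, vertexShift, vertexShift, if_pos le_rfl, if_neg (by omega)]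
  simp

theorem altSign_mul_edgeShift_re_self (hε : 0 < ε) (hq : ε * q ^ 2 ≤ 1 / 4) :
    altSign q * (edgeShift ε q q).re ≤ 0 ∧
      -(21 / 160) ≤ altSign q * (edgeShift ε q q).re := by
  have hre : (edgeShift ε q q).re = -lateralShift ε q := by
    rw [edgeShift, vertexShift, vertexShift, if_pos le_rfl, if_neg (by omega)]
    simp
  rw [hre]
  cases q with
  | zero =>
    simp only [lateralShift]
    norm_num
  | succ i =>
    have hi := bend_pos hε i
    have hle := bend_le_eighth hε hq i.lt_succ_self
    rw [altSign_succ, neg_mul_neg, altSign_mul_lateralShift_succ]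
    rcases altSign_eq i with h | h <;> rw [h] <;> constructor <;> linarith

theorem bentLen_pos_of_lt (hε : 0 < ε) (hε1 : ε ≤ 1) (hq : ε * q ^ 2 ≤ 1 / 4) {j : ℕ}
    (hj : j < q) : 0 < bentLen ε q j := by
  have hs := sin_bend_pos hε hε1 hq hj.le
  have hb := bend_pos hε j
  have h := lt_turnedLen_mul_sin (d := edgeShift ε q j) (altSign_eq j) hs.ne'
    (by rw [edgeShift_im_of_lt hj]; linarith)
  rw [edgeShift_im_of_lt hj] at h
  have h' := (altSign_mul_edgeShift_re_of_lt hε hj).2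
  exact pos_of_mul_pos_left (lt_of_le_of_lt (by linarith) h) hs.le

theorem lt_bentLen_self_mul_sin (hε : 0 < ε) (hε1 : ε ≤ 1) (hq : ε * q ^ 2 ≤ 1 / 4) :
    0.69 < bentLen ε q q * sin (bend ε q) := by
  have h := lt_turnedLen_mul_sin (d := edgeShift ε q q) (altSign_eq q)
    (sin_bend_pos hε hε1 hq le_rfl).ne' (by rw [edgeShift_im_self]; linarith)
  rw [edgeShift_im_self] at h
  have h' := (altSign_mul_edgeShift_re_self hε hq).2
  rw [bentLen]
  linarith

theorem sin_bend_ge (hε : 0 < ε) (hq : ε * q ^ 2 ≤ 1 / 4) {j : ℕ} (hj : j < q) :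
    bend ε j ≤ 1.01 * sin (bend ε j) := by
  have hb := bend_pos hε j
  have hb' := bend_le_eighth hε hq hj
  have h := sin_gt_sub_cube hb
  have : bend ε j ^ 3 ≤ bend ε j / 64 := by nlinarith [mul_pos hb hb]
  linarith

theorem straightLen_bounds_of_lt (hε : 0 < ε) (hε1 : ε ≤ 1) (hq : ε * q ^ 2 ≤ 1 / 4) {j : ℕ}
    (hj : j < q) : 0 < straightLen ε q j ∧ straightLen ε q j ≤ 1.01 := by
  have hs := sin_bend_pos hε hε1 hq hj.le
  have hb := bend_pos hε j
  have hre := altSign_mul_edgeShift_re_of_lt hε hj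
  have him := edgeShift_im_of_lt (ε := ε) hj
  have h := unturnedLen_mul_sin_bounds (d := edgeShift ε q j) (altSign_eq j) hb
    (by linarith) hre.1 (Or.inl ⟨bend_le_eighth hε hq hj, by rw [him]; linarith⟩)
  refine ⟨pos_of_mul_pos_left h.1 hs.le, le_of_mul_le_mul_right (h.2.trans ?_) hs⟩
  rw [him, neg_neg]
  exact sin_bend_ge hε hq hj

theorem straightLen_self_bounds (hε : 0 < ε) (hε1 : ε ≤ 1) (hq : ε * q ^ 2 ≤ 1 / 4) :
    0 < straightLen ε q q ∧ straightLen ε q q * sin (bend ε q) ≤ 1 := by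
  have hs := sin_bend_pos hε hε1 hq le_rfl
  have hre := altSign_mul_edgeShift_re_self hε hq
  have him := edgeShift_im_self (ε := ε) (q := q)
  have h := unturnedLen_mul_sin_bounds (d := edgeShift ε q q) (altSign_eq q) (bend_pos hε q)
    (by linarith) hre.1 (Or.inr ⟨bend_le_half hε hε1 hq, by rw [him]; linarith⟩)
  refine ⟨pos_of_mul_pos_left h.1 hs.le, h.2.trans ?_⟩
  rw [him]
  have : 0 ≤ ε * q ^ 2 / 2 := by positivity
  linarith

theorem hangLen_formulas {j : ℕ} (hj : j < q) (hs : sin (bend ε j) ≠ 0) :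
    bentHangLen ε q j = (11 / 20 - altSign j / 2) * (bend ε j / sin (bend ε j)) ∧
    straightHangLen ε q j = altSign j * (1 - ε * (j + 1) ^ 2 / 2) +
      (11 / 20 - altSign j / 2) * (bend ε j / sin (bend ε j)) * cos (bend ε j) := by
  rw [bentHangLen, straightHangLen, turnedLen, unturnedLen, vertexShift,
    if_pos (show j + 1 ≤ q from hj)]
  have e := altSign_mul_lateralShift_succ (ε := ε) j
  simp only [Complex.neg_re, Complex.neg_im]
  push_cast
  rcases altSign_eq j with h | h <;> rw [h] at e ⊢ <;>
    simp only [one_mul, neg_one_mul, sin_sub, cos_sub, sin_neg, cos_neg, sin_pi_div_two,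
        cos_pi_div_two] at e ⊢ <;>
    refine ⟨?_, ?_⟩ <;> field_simp
  · linear_combination (-40) * e
  · linear_combination (-40) * cos (bend ε j) * e
  · linear_combination (-40) * e
  · linear_combination (-40) * cos (bend ε j) * e

theorem hangLen_bounds (hε : 0 < ε) (hε1 : ε ≤ 1) (hq : ε * q ^ 2 ≤ 1 / 4) {j : ℕ} (hj : j < q) :
    0 < bentHangLen ε q j ∧ 0 < straightHangLen ε q j ∧ straightHangLen ε q j ≤ 1.06 := by
  have hs := sin_bend_pos hε hε1 hq hj.le
  have hb := bend_pos hε j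
  have hb8 := bend_le_eighth hε hq hj
  obtain ⟨h1, h2⟩ := hangLen_formulas (ε := ε) hj hs.ne'
  have r1 : 1 ≤ bend ε j / sin (bend ε j) := (one_le_div hs).2 (sin_le hb.le)
  have r2 : bend ε j / sin (bend ε j) ≤ 1.01 := (div_le_iff₀ hs).2 (sin_bend_ge hε hq hj)
  have hc : 0.99 ≤ cos (bend ε j) := by nlinarith [one_sub_sq_div_two_le_cos (x := bend ε j)]
  have hc1 := cos_le_one (bend ε j)
  have hY0 : 0 ≤ ε * ((j : ℝ) + 1) ^ 2 / 2 := by positivity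
  have hY : ε * ((j : ℝ) + 1) ^ 2 / 2 ≤ 1 / 8 := by
    have : (j : ℝ) + 1 ≤ q := by exact_mod_cast hj
    have : ε * ((j : ℝ) + 1) ^ 2 ≤ ε * q ^ 2 := by gcongr
    linarith
  have p1 : 0.99 ≤ bend ε j / sin (bend ε j) * cos (bend ε j) := by nlinarith
  have p2 : bend ε j / sin (bend ε j) * cos (bend ε j) ≤ 1.01 := by nlinarith
  rw [h1, h2, mul_assoc]
  rcases altSign_eq j with h | h <;> rw [h] <;> refine ⟨?_, ?_, ?_⟩ <;> linarith

end Bend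

section Construction

variable (ε η : ℝ) (q : ℕ)

/-- The exact drawing, with a tail of edges of length `η` and two arms. -/
def straightTripod : TripodDrawing :=
  zigzag 0 ![fun _ => η, straightLen ε q, straightLen ε q]
    ![fun _ => η, straightHangLen ε q, straightHangLen ε q] 0

/-- The approximate drawing, with the centre moved up by `1` and both arms bent downwards. -/
def bentTripod : TripodDrawing :=
  zigzag Complex.I ![fun j => if j = 0 then 1 + η else η, bentLen ε q, bentLen ε q]
    ![fun _ => η, bentHangLen ε q, bentHangLen ε q] ![0, bend ε, bend ε]

variable {ε η q}

theorem nondegenerate_straightTripod (hε : 0 < ε) (hε1 : ε ≤ 1) (hq : ε * q ^ 2 ≤ 1 / 4)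
    (hη : 0 < η) (M : ℕ) : (straightTripod ε η q).Nondegenerate ![M, q, q] := by
  have h1 : ∀ j ≤ q, 0 < straightLen ε q j := fun j hj => by
    rcases hj.lt_or_eq with h | rfl
    · exact (straightLen_bounds_of_lt hε hε1 hq h).1
    · exact (straightLen_self_bounds hε hε1 hq).1
  have h2 : ∀ j < q, 0 < straightHangLen ε q j := fun j hj => (hangLen_bounds hε hε1 hq hj).2.1
  constructor <;> intro κ i hi <;> fin_cases κ
  exacts [hη, h1 i hi, h1 i hi, hη, h2 i hi, h2 i hi]

theorem nondegenerate_bentTripod (hε : 0 < ε) (hε1 : ε ≤ 1) (hq : ε * q ^ 2 ≤ 1 / 4)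
    (hη : 0 < η) (M : ℕ) : (bentTripod ε η q).Nondegenerate ![M, q, q] := by
  have h0 : ∀ j : ℕ, 0 < if j = 0 then 1 + η else η := fun j => by split_ifs <;> linarith
  have h1 : ∀ j ≤ q, 0 < bentLen ε q j := fun j hj => by
    rcases hj.lt_or_eq with h | rfl
    · exact bentLen_pos_of_lt hε hε1 hq h
    · exact pos_of_mul_pos_left (lt_trans (by norm_num) (lt_bentLen_self_mul_sin hε hε1 hq))
        (sin_bend_pos hε hε1 hq le_rfl).le
  have h2 : ∀ j < q, 0 < bentHangLen ε q j := fun j hj => (hangLen_bounds hε hε1 hq hj).1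
  constructor <;> intro κ i hi <;> fin_cases κ
  exacts [h0 i, h1 i hi, h1 i hi, hη, h2 i hi, h2 i hi]

theorem bentTripod_spine_zero (i : ℕ) :
    (bentTripod ε η q).spine 0 (i + 1) = (straightTripod ε η q).spine 0 (i + 1) := by
  induction i with
  | zero =>
    have h : -(2 * π / 3) + 1 * (altSign 0 * (π / 6) - 0) = -(π / 2) := by
      rw [altSign_zero]; ring
    simp only [TripodDrawing.spine, bentTripod, straightTripod, zigzag, zero_add,
      Finset.sum_range_one, Matrix.cons_val, Pi.zero_apply, if_true, h]
    apply Complex.ext <;> simp [unitDir]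
  | succ i ih =>
    rw [TripodDrawing.spine_succ, ih, TripodDrawing.spine_succ _ _ (i + 1)]
    simp [bentTripod, straightTripod, zigzag]

theorem vertexShift_zero : vertexShift ε q 0 = Complex.I := by
  apply Complex.ext <;> simp [vertexShift, lateralShift]

theorem bentTripod_spine_one (hs : ∀ j ≤ q, sin (bend ε j) ≠ 0) {i : ℕ} (hi : i ≤ q + 1) :
    (bentTripod ε η q).spine 1 i = (straightTripod ε η q).spine 1 i + vertexShift ε q i := by
  induction i with
  | zero => simp [TripodDrawing.spine, bentTripod, straightTripod, zigzag, vertexShift_zero]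
  | succ i ih =>
    rw [TripodDrawing.spine_succ, ih (by omega), TripodDrawing.spine_succ]
    have h := turnedLen_smul_unitDir (α := altSign i * (π / 6)) (hs i (by omega)) (edgeShift ε q i)
    simp only [bentTripod, straightTripod, zigzag, Matrix.cons_val, Pi.zero_apply, one_mul,
      zero_add, sub_zero] at h ⊢
    rw [bentLen, h, straightLen, edgeShift]
    ring

theorem bentTripod_spine_two (hs : ∀ j ≤ q, sin (bend ε j) ≠ 0) {i : ℕ} (hi : i ≤ q + 1) :
    (bentTripod ε η q).spine 2 i =
      (straightTripod ε η q).spine 2 i + reflectIm (vertexShift ε q i) := by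
  induction i with
  | zero =>
    simp only [TripodDrawing.spine, bentTripod, straightTripod, zigzag, vertexShift_zero]
    apply Complex.ext <;> simp [reflectIm]
  | succ i ih =>
    rw [TripodDrawing.spine_succ, ih (by omega), TripodDrawing.spine_succ]
    have h := turnedLen_smul_unitDir_reflect (α := altSign i * (π / 6)) (hs i (by omega))
      (edgeShift ε q i)
    have h' : reflectIm (edgeShift ε q i) =
        reflectIm (vertexShift ε q (i + 1)) - reflectIm (vertexShift ε q i) := by
      apply Complex.ext <;> simp [reflectIm, edgeShift]
      ring
    simp only [bentTripod, straightTripod, zigzag, Matrix.cons_val, Pi.zero_apply, neg_one_mul,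
      ← sub_eq_add_neg, sub_zero] at h ⊢
    rw [bentLen, h, straightLen, h']
    ring

theorem straightTripod_pos_terminal (hs : ∀ j ≤ q, sin (bend ε j) ≠ 0) (M : ℕ)
    (t : Fin 3 ⊕ (Σ κ, Fin ((![M, q, q] : Fin 3 → ℕ) κ))) :
    (straightTripod ε η q).pos ![M, q, q] (Sum.inl t) =
      (bentTripod ε η q).pos ![M, q, q] (Sum.inl t) := by
  have hend : vertexShift ε q (q + 1) = 0 := if_neg (by omega)
  have hr : reflectIm 0 = 0 := by apply Complex.ext <;> simp [reflectIm]
  rcases t with κ | ⟨κ, i⟩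
  · fin_cases κ
    · exact (bentTripod_spine_zero M).symm
    · have h := bentTripod_spine_one (η := η) hs (le_refl (q + 1))
      rw [hend, add_zero] at h
      exact h.symm
    · have h := bentTripod_spine_two (η := η) hs (le_refl (q + 1))
      rw [hend, hr, add_zero] at h
      exact h.symm
  · fin_cases κ
    · change (straightTripod ε η q).spine 0 (i + 1) + _ = (bentTripod ε η q).spine 0 (i + 1) + _
      rw [bentTripod_spine_zero]
      rfl
    · have hi : (i : ℕ) < q := i.2
      change (straightTripod ε η q).spine 1 (i + 1) + _ = (bentTripod ε η q).spine 1 (i + 1) + _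
      rw [bentTripod_spine_one hs (by omega)]
      have h := turnedLen_smul_unitDir (α := altSign i * (π / 2)) (hs i (by omega))
        (-vertexShift ε q (i + 1))
      simp only [bentTripod, straightTripod, zigzag, Matrix.cons_val, Pi.zero_apply, one_mul,
        zero_add, sub_zero, Fin.mk_one] at h ⊢
      rw [bentHangLen, h, straightHangLen]
      ring
    · have hi : (i : ℕ) < q := i.2
      change (straightTripod ε η q).spine 2 (i + 1) + _ = (bentTripod ε η q).spine 2 (i + 1) + _
      rw [bentTripod_spine_two hs (by omega)]
      have h := turnedLen_smul_unitDir_reflect (α := altSign i * (π / 2)) (hs i (by omega))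
        (-vertexShift ε q (i + 1))
      have h' : reflectIm (-vertexShift ε q (i + 1)) = -reflectIm (vertexShift ε q (i + 1)) := by
        apply Complex.ext <;> simp [reflectIm]
      simp only [bentTripod, straightTripod, zigzag, Matrix.cons_val, Pi.zero_apply, neg_one_mul,
        ← sub_eq_add_neg, sub_zero, Fin.reduceFinMk] at h ⊢
      rw [bentHangLen, h, straightHangLen, h']
      ring

/-- The numerical comparison of the gain on the two long edges with the total length. -/
theorem bend_gain (hε : 0 < ε) (hε1 : ε ≤ 1) (hq : ε * q ^ 2 ≤ 1 / 4) {c t : ℝ}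
    (ht : t ≤ 1 / 10) (hc : c * ε ≤ 4 * bend ε q ^ 2) (hc0 : 0 < c) :
    c / 24 * ε * (t + 2 * (straightLen ε q q +
      ∑ i : Fin q, (straightLen ε q i + straightHangLen ε q i))) <
      2 * (bentLen ε q q * (1 - cos (bend ε q))) := by
  set Θ := bend ε q with hΘdef
  have hΘ : 0 < Θ := bend_pos hε q
  have hΘ2 : Θ ≤ 1 / 2 := bend_le_half hε hε1 hq
  have hs : 0 < sin Θ := sin_bend_pos hε hε1 hq le_rfl
  have hsΘ : sin Θ ≤ Θ := sin_le hΘ.le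
  have hqΘ : q * Θ ≤ 3 / 8 := by
    have : (q : ℝ) ≤ q ^ 2 := by exact_mod_cast Nat.le_self_pow two_ne_zero q
    rw [hΘdef, bend]
    nlinarith
  have hsum : ∑ i : Fin q, (straightLen ε q i + straightHangLen ε q i) ≤ q * 2.07 := by
    have := Finset.sum_le_card_nsmul Finset.univ
      (fun i : Fin q => straightLen ε q i + straightHangLen ε q i) 2.07 fun i _ => by
        have h1 := (straightLen_bounds_of_lt hε hε1 hq i.2).2
        have h2 := (hangLen_bounds hε hε1 hq i.2).2.2
        linarith
    simpa using this
  have hb := (straightLen_self_bounds hε hε1 hq).2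
  have ha := lt_bentLen_self_mul_sin hε hε1 hq
  have hcos : cos Θ ≤ 1 - Θ ^ 2 / 2 + Θ ^ 4 * (5 / 96) := by
    have := (abs_le.1 (cos_bound (x := Θ) (by rw [abs_of_pos hΘ]; linarith))).2
    rw [abs_of_pos hΘ] at this
    linarith
  have hgain : 0.48 * Θ ^ 2 ≤ 1 - cos Θ := by
    have : Θ ^ 2 ≤ 1 / 4 := by nlinarith
    have : Θ ^ 4 ≤ Θ ^ 2 / 4 := by nlinarith [sq_nonneg Θ]
    linarith [sq_nonneg Θ]
  set A := ∑ i : Fin q, (straightLen ε q i + straightHangLen ε q i)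
  have hlen : (t + 2 * (straightLen ε q q + A)) * sin Θ ≤ 3.63 := by
    have h1 : A * sin Θ ≤ q * 2.07 * sin Θ := by gcongr
    have h2 : (q : ℝ) * sin Θ ≤ q * Θ := by gcongr
    have h3 : t * sin Θ ≤ 1 / 10 * sin Θ := by gcongr
    nlinarith
  refine lt_of_mul_lt_mul_right ?_ hs.le
  have hce : 0 < c * ε := by positivity
  have hΘsq : 0 < Θ ^ 2 := by positivity
  calc c / 24 * ε * (t + 2 * (straightLen ε q q + A)) * sin Θ
      = c * ε / 24 * ((t + 2 * (straightLen ε q q + A)) * sin Θ) := by ring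
    _ ≤ c * ε / 24 * 3.63 := by gcongr
    _ ≤ 4 * Θ ^ 2 / 24 * 3.63 := by gcongr
    _ < 2 * (0.69 * (0.48 * Θ ^ 2)) := by linarith
    _ ≤ 2 * ((bentLen ε q q * sin Θ) * (1 - cos Θ)) := by gcongr
    _ = 2 * (bentLen ε q q * (1 - cos Θ)) * sin Θ := by ring

end Construction

/-- For every `k ≥ 1` and `0 < c < 1`, if `ε = c/k²` then `G₂(ε, 2^k + 1) > (c/24)·ε`:
there is a full `ε`-approximate Steiner tree `T` on `2^k + 1` terminals in `ℝ²` whose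
shortest same-topology tree `S(T)` is a non-degenerate locally minimum Steiner tree and
which satisfies `L(T) > (1 + (c/24)ε)·L(S(T))`. -/
theorem steiner_plane_lower_bound_locally_min (k : ℕ) (hk : 1 ≤ k)
    (c : ℝ) (hc0 : 0 < c) (hc1 : c < 1)
    (ε : ℝ) (hε : ε = c / (k : ℝ) ^ 2) :
    ∃ (G : FullSteinerTopology (2 ^ k + 1))
      (pos pos' : SteinerVert (2 ^ k + 1) → Epc 2),
      IsApproxSteiner ε G pos ∧
      (∀ t : Fin (2 ^ k + 1), pos' (Sum.inl t) = pos (Sum.inl t)) ∧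
      treeLength G pos' = minTreeLength G pos ∧
      IsLocallyMinimumTree G pos' ∧
      treeLength G pos > (1 + (c / 24) * ε) * treeLength G pos' := by
  have hk1 : (1 : ℝ) ≤ k := by exact_mod_cast hk
  have hεk : ε * k ^ 2 = c := by rw [hε]; field_simp
  have hε0 : 0 < ε := by rw [hε]; positivity
  have hε1 : ε ≤ 1 := by nlinarith
  obtain ⟨q, hqk, hkq⟩ : ∃ q, 2 * q ≤ k ∧ k ≤ 2 * q + 1 := ⟨k / 2, by omega, by omega⟩
  have hqk' : 2 * (q : ℝ) ≤ k := by exact_mod_cast hqk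
  have hkq' : (k : ℝ) ≤ 2 * q + 1 := by exact_mod_cast hkq
  have hq : ε * q ^ 2 ≤ 1 / 4 := by
    have : ε * (2 * (q : ℝ)) ^ 2 ≤ ε * k ^ 2 := by gcongr
    linarith
  have hpow : k + 1 ≤ 2 ^ k := Nat.lt_two_pow_self
  obtain ⟨M, hM⟩ : ∃ M, 2 ^ k + 1 = 3 + M + 2 * q := by
    refine ⟨2 ^ k + 1 - (3 + 2 * q), ?_⟩
    have : 2 * q + 2 ≤ 2 ^ k := by
      rcases hqk.lt_or_eq with h | h
      · omega
      · have : 2 ∣ 2 ^ k := dvd_pow_self 2 (by omega)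
        omega
    omega
  have hη : 0 < 1 / (10 * (2 * (M : ℝ) + 1)) := by positivity
  set η := 1 / (10 * (2 * (M : ℝ) + 1)) with hηdef
  have hs : ∀ j ≤ q, sin (bend ε j) ≠ 0 := fun j hj => (sin_bend_pos hε0 hε1 hq hj).ne'
  refine exists_steiner_tree_of_tripod (n := ![M, q, q])
    (by rw [hM, Fin.sum_univ_three]; simp only [Matrix.cons_val]; ring)
    (straightTripod ε η q) (bentTripod ε η q)
    (nondegenerate_straightTripod hε0 hε1 hq hη M) (nondegenerate_bentTripod hε0 hε1 hq hη M)
    (zigzag_nearlyEquiangular _ _ _ _ zero_le_one (by simp) rfl (by simp) rfl)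
    (sum_unitDir_zigzag _ _ _ _)
    (zigzag_nearlyEquiangular _ _ _ _ hε1 (fun κ j => ?_) rfl ?_ rfl)
    (straightTripod_pos_terminal hs M) ?_
  · have hb : |bend ε (j + 1) - bend ε j| ≤ ε := by
      rw [show bend ε (j + 1) - bend ε j = ε by unfold bend; push_cast; ring, abs_of_pos hε0]
    fin_cases κ
    · simpa using hε0.le
    · exact hb
    · exact hb
  · change |2 * bend ε 0| ≤ ε
    rw [show 2 * bend ε 0 = ε by unfold bend; push_cast; ring, abs_of_pos hε0]
  · have hc : c * ε ≤ 4 * bend ε q ^ 2 := by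
      have : (ε * k) ^ 2 ≤ (ε * (2 * q + 1)) ^ 2 := by gcongr
      rw [← hεk, bend]
      nlinarith
    have ht : η + ∑ _i : Fin M, (η + η) ≤ 1 / 10 := by
      have : η + ∑ _i : Fin M, (η + η) = 1 / 10 := by
        simp only [Finset.sum_const, Finset.card_univ, Fintype.card_fin, nsmul_eq_mul, hηdef]
        field_simp
        ring
      exact this.le
    have hgain := bend_gain hε0 hε1 hq ht hc hc0
    have e0 : (bentTripod ε η q).dir 0 M - (straightTripod ε η q).dir 0 M = 0 := by
      simp [bentTripod, straightTripod, zigzag]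
    have e1 : (bentTripod ε η q).dir 1 q - (straightTripod ε η q).dir 1 q = -bend ε q := by
      simp [bentTripod, straightTripod, zigzag]
    have e2 : (bentTripod ε η q).dir 2 q - (straightTripod ε η q).dir 2 q = bend ε q := by
      simp [bentTripod, straightTripod, zigzag]
    rw [Fin.sum_univ_three, Fin.sum_univ_three]
    simp only [Matrix.cons_val]
    rw [e0, e1, e2, cos_zero, cos_neg]
    simp only [straightTripod, bentTripod, zigzag, Matrix.cons_val]
    change c / 24 * ε * (η + ∑ _i : Fin M, (η + η) +
      (straightLen ε q q + ∑ i : Fin q, (straightLen ε q i + straightHangLen ε q i)) +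
      (straightLen ε q q + ∑ i : Fin q, (straightLen ε q i + straightHangLen ε q i))) < _
    linarith

end
end

section
/- For every dimension d ≥ 2, every real ε > 0, and every integer n ≥ 3, F_d(ε, n) ≤ F_d(ε, n+1). -/
open Real

noncomputable section

/-! ### Attaching a leaf to a graph -/

section Graph

variable {W : Type*}

/-- The graph obtained from `H` by adding one new vertex `none`, joined to `t` only. -/
def attachLeaf (H : SimpleGraph W) (t : W) : SimpleGraph (Option W) where
  Adj
    | some u, some v => H.Adj u v
    | some u, none => u = t
    | none, some v => v = t
    | none, none => False
  symm := ⟨by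
    rintro (_ | u) (_ | v) h
    · exact h
    · exact h
    · exact h
    · exact H.symm.symm _ _ h⟩
  loopless := ⟨by
    rintro (_ | u) h
    · exact h
    · exact H.irrefl h⟩

@[simp] lemma attachLeaf_adj_some_some (H : SimpleGraph W) (t u v : W) :
    (attachLeaf H t).Adj (some u) (some v) ↔ H.Adj u v := Iff.rfl

@[simp] lemma attachLeaf_adj_some_none (H : SimpleGraph W) (t u : W) :
    (attachLeaf H t).Adj (some u) none ↔ u = t := Iff.rfl

@[simp] lemma attachLeaf_adj_none_some (H : SimpleGraph W) (t v : W) :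
    (attachLeaf H t).Adj none (some v) ↔ v = t := Iff.rfl

@[simp] lemma attachLeaf_adj_none_none (H : SimpleGraph W) (t : W) :
    ¬ (attachLeaf H t).Adj none none := id

lemma attachLeaf_connected {H : SimpleGraph W} (hH : H.Connected) (t : W) :
    (attachLeaf H t).Connected := by
  let f : H →g attachLeaf H t := ⟨some, id⟩
  have key : ∀ x, (attachLeaf H t).Reachable (some t) x := by
    rintro (_ | x)
    · exact SimpleGraph.Adj.reachable (by simp)
    · exact (hH.preconnected t x).map f
  exact { preconnected := fun x y => (key x).symm.trans (key y), nonempty := ⟨none⟩ }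

lemma attachLeaf_edgeSet (H : SimpleGraph W) (t : W) :
    (attachLeaf H t).edgeSet = insert s(some t, none) (Sym2.map some '' H.edgeSet) := by
  ext e
  induction e using Sym2.ind with
  | _ x y =>
    simp only [SimpleGraph.mem_edgeSet, Set.mem_insert_iff, Set.mem_image]
    constructor
    · intro h
      rcases x with _ | x <;> rcases y with _ | y
      · simp at h
      · left; simp_all
      · left; simp_all
      · right; exact ⟨s(x, y), by simpa using h, rfl⟩
    · rintro (h | ⟨e, he, h⟩)
      · rw [Sym2.eq_iff] at h
        rcases h with ⟨rfl, rfl⟩ | ⟨rfl, rfl⟩ <;> simp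
      · induction e using Sym2.ind with
        | _ u v =>
          rw [Sym2.map_mk, Sym2.eq_iff] at h
          rcases h with ⟨rfl, rfl⟩ | ⟨rfl, rfl⟩
          · simpa using he
          · simpa using H.symm.symm _ _ he

lemma attachLeaf_isTree [Finite W] {H : SimpleGraph W} (hH : H.IsTree) (t : W) :
    (attachLeaf H t).IsTree := by
  rw [SimpleGraph.isTree_iff_connected_and_card] at hH ⊢
  refine ⟨attachLeaf_connected hH.1 t, ?_⟩
  have h2 := hH.2
  rw [attachLeaf_edgeSet, Finite.card_option, ← h2, Nat.card_coe_set_eq, Nat.card_coe_set_eq,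
    Set.ncard_insert_of_notMem, Set.ncard_image_of_injective]
  · exact Sym2.map.injective (Option.some_injective _)
  · rintro ⟨e, -, h⟩
    induction e using Sym2.ind with
    | _ u v => simp at h

lemma attachLeaf_neighborSet_none (H : SimpleGraph W) (t : W) :
    (attachLeaf H t).neighborSet none = {some t} := by
  ext (_ | x) <;> simp

lemma attachLeaf_neighborSet_self (H : SimpleGraph W) (t : W) :
    (attachLeaf H t).neighborSet (some t) = insert none (some '' H.neighborSet t) := by
  ext (_ | x) <;> simp

lemma attachLeaf_neighborSet_of_ne (H : SimpleGraph W) {t v : W} (h : v ≠ t) :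
    (attachLeaf H t).neighborSet (some v) = some '' H.neighborSet v := by
  ext (_ | x) <;> simp [h]

lemma attachLeaf_ncard_self [Finite W] (H : SimpleGraph W) (t : W) :
    ((attachLeaf H t).neighborSet (some t)).ncard = (H.neighborSet t).ncard + 1 := by
  rw [attachLeaf_neighborSet_self, Set.ncard_insert_of_notMem (by simp),
    Set.ncard_image_of_injective _ (Option.some_injective _)]

lemma attachLeaf_ncard_of_ne (H : SimpleGraph W) {t v : W} (h : v ≠ t) :
    ((attachLeaf H t).neighborSet (some v)).ncard = (H.neighborSet v).ncard := by
  rw [attachLeaf_neighborSet_of_ne H h, Set.ncard_image_of_injective _ (Option.some_injective _)]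

/-- In a tree with at least three edges at `v`, two distinct neighbours of `v` are farther
from `r` than `v`. -/
lemma exists_two_farther_neighbors {H : SimpleGraph W} (hH : H.IsTree) (r v : W)
    (hv : (H.neighborSet v).ncard = 3) :
    ∃ a b, a ≠ b ∧ H.Adj v a ∧ H.Adj v b ∧ H.dist r a = H.dist r v + 1 ∧
      H.dist r b = H.dist r v + 1 := by
  have uniq : ∀ a b, H.Adj v a → H.Adj v b → H.dist r v = H.dist r a + 1 →
      H.dist r v = H.dist r b + 1 → a = b := by
    have aux : ∀ a, H.Adj v a → H.dist r v = H.dist r a + 1 →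
        ∃ p : H.Walk r v, p.IsPath ∧ p.penultimate = a := by
      intro a ha hd
      obtain ⟨p, hp⟩ := hH.connected.exists_walk_length_eq_dist r a
      refine ⟨p.concat ha.symm, ?_, by simp⟩
      apply SimpleGraph.Walk.isPath_of_length_eq_dist
      rw [SimpleGraph.Walk.length_concat, hp, hd]
    intro a b ha hb hda hdb
    obtain ⟨p, hp, rfl⟩ := aux a ha hda
    obtain ⟨q, hq, rfl⟩ := aux b hb hdb
    have := (hH.existsUnique_path r v).unique hp hq
    rw [this]
  obtain ⟨x, y, z, hxy, hxz, hyz, hs⟩ := Set.ncard_eq_three.1 hv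
  have hm : ∀ w, H.Adj v w ↔ w = x ∨ w = y ∨ w = z := by
    intro w
    rw [← SimpleGraph.mem_neighborSet, hs]; simp
  have hx := (hm x).2 (by simp)
  have hy := (hm y).2 (by simp)
  have hz := (hm z).2 (by simp)
  rcases hH.dist_eq_dist_add_one_of_adj r hx with h1 | h1 <;>
  rcases hH.dist_eq_dist_add_one_of_adj r hy with h2 | h2 <;>
  rcases hH.dist_eq_dist_add_one_of_adj r hz with h3 | h3
  · exact absurd (uniq x y hx hy h1 h2) hxy
  · exact absurd (uniq x y hx hy h1 h2) hxy
  · exact absurd (uniq x z hx hz h1 h3) hxz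
  · exact ⟨y, z, hyz, hy, hz, h2, h3⟩
  · exact absurd (uniq y z hy hz h2 h3) hyz
  · exact ⟨x, z, hxz, hx, hz, h1, h3⟩
  · exact ⟨x, y, hxy, hx, hy, h1, h2⟩
  · exact ⟨x, y, hxy, hx, hy, h1, h2⟩

/-! ### Length of a drawn graph -/

open Classical in
/-- The contribution of the ordered pair `(u, v)` to the length of the graph `H` drawn at `p`. -/
def edgeLength {E : Type*} [Dist E] (H : SimpleGraph W) (p : W → E) (u v : W) : ℝ :=
  if H.Adj u v then dist (p u) (p v) else 0

/-- The total length of the edges of the finite graph `H` drawn at `p`. -/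
def graphLength {E : Type*} [Dist E] [Fintype W] (H : SimpleGraph W) (p : W → E) : ℝ :=
  (1 / 2) * ∑ u : W, ∑ v : W, edgeLength H p u v

variable {E : Type*} [PseudoMetricSpace E]

lemma edgeLength_nonneg (H : SimpleGraph W) (p : W → E) (u v : W) : 0 ≤ edgeLength H p u v := by
  unfold edgeLength
  split_ifs <;> positivity

lemma edgeLength_le (H : SimpleGraph W) (p : W → E) (u v : W) :
    edgeLength H p u v ≤ dist (p u) (p v) := by
  unfold edgeLength
  split_ifs
  · exact le_rfl
  · positivity

variable [Fintype W]

lemma graphLength_nonneg (H : SimpleGraph W) (p : W → E) : 0 ≤ graphLength H p :=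
  mul_nonneg (by norm_num) (Finset.sum_nonneg fun u _ => Finset.sum_nonneg fun v _ =>
    edgeLength_nonneg H p u v)

lemma graphLength_attachLeaf (H : SimpleGraph W) (t : W) (p : Option W → E) :
    graphLength (attachLeaf H t) p =
      graphLength H (fun w => p (some w)) + dist (p none) (p (some t)) := by
  classical
  have h0 : edgeLength (attachLeaf H t) p none none = 0 := by simp [edgeLength]
  have h1 : ∀ x, edgeLength (attachLeaf H t) p (some x) none =
      if x = t then dist (p none) (p (some t)) else 0 := by
    intro x
    by_cases h : x = t
    · simp [edgeLength, h, dist_comm]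
    · simp [edgeLength, h]
  have h2 : ∀ x, edgeLength (attachLeaf H t) p none (some x) =
      if x = t then dist (p none) (p (some t)) else 0 := by
    intro x
    by_cases h : x = t <;> simp [edgeLength, h]
  have h3 : ∀ x y, edgeLength (attachLeaf H t) p (some x) (some y) =
      edgeLength H (fun w => p (some w)) x y := fun x y => by
    simp [edgeLength]
  simp only [graphLength, Fintype.sum_option, h0, h1, h2, h3, Finset.sum_add_distrib,
    Finset.sum_ite_eq', Finset.mem_univ, if_true]
  ring

lemma graphLength_comap {W' : Type*} [Fintype W'] (H : SimpleGraph W) (e : W' ≃ W) (p : W' → E) :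
    graphLength (H.comap e) p = graphLength H (fun w => p (e.symm w)) := by
  unfold graphLength
  congr 1
  refine Fintype.sum_equiv e _ _ fun u => Fintype.sum_equiv e _ _ fun v => ?_
  simp only [edgeLength, Equiv.symm_apply_apply]
  congr!

lemma dist_le_two_mul_graphLength (H : SimpleGraph W) (p : W → E) {u v : W} (h : H.Adj u v) :
    dist (p u) (p v) ≤ 2 * graphLength H p := by
  unfold graphLength
  rw [← mul_assoc, mul_one_div_cancel (two_ne_zero), one_mul]
  calc dist (p u) (p v) = edgeLength H p u v := by rw [edgeLength, if_pos h]
    _ ≤ ∑ b, edgeLength H p u b :=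
      Finset.single_le_sum (fun b _ => edgeLength_nonneg H p u b) (Finset.mem_univ v)
    _ ≤ _ := Finset.single_le_sum (f := fun a => ∑ b, edgeLength H p a b)
        (fun a _ => Finset.sum_nonneg fun b _ => edgeLength_nonneg H p a b) (Finset.mem_univ u)

lemma dist_le_card_mul_graphLength {H : SimpleGraph W} (hH : H.Connected) (p : W → E) (u v : W) :
    dist (p u) (p v) ≤ 2 * Fintype.card W * graphLength H p := by
  obtain ⟨q, hq⟩ := hH.exists_walk_length_eq_dist u v
  have h1 : q.length < Fintype.card W := (q.isPath_of_length_eq_dist hq).length_lt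
  have h2 : dist (p u) (p v) ≤ q.length * (2 * graphLength H p) := by
    clear hq h1
    induction q with
    | nil => simp
    | @cons u v w h q ih =>
      rw [SimpleGraph.Walk.length_cons]
      push_cast
      linarith [dist_triangle (p u) (p v) (p w), dist_le_two_mul_graphLength H p h]
  have h3 : (q.length : ℝ) ≤ Fintype.card W := by exact_mod_cast h1.le
  have := mul_le_mul_of_nonneg_right h3 (mul_nonneg zero_le_two (graphLength_nonneg H p))
  linarith

lemma graphLength_le_of_dist_le (H : SimpleGraph W) (p : W → E) {D : ℝ} (hD : 0 ≤ D)
    (h : ∀ u v, dist (p u) (p v) ≤ D) :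
    graphLength H p ≤ (Fintype.card W : ℝ) ^ 2 * D := by
  unfold graphLength
  have : (∑ u : W, ∑ v : W, edgeLength H p u v) ≤ ∑ u : W, ∑ v : W, D :=
    Finset.sum_le_sum fun u _ => Finset.sum_le_sum fun v _ => (edgeLength_le H p u v).trans (h u v)
  simp only [Finset.sum_const, Finset.card_univ, nsmul_eq_mul] at this
  have h0 : (0 : ℝ) ≤ Fintype.card W * (Fintype.card W * D) := by positivity
  nlinarith

end Graph

/-! ### Angles -/

section Angle

open EuclideanGeometry

/-- In a triangle whose angle at `s` is bounded below, the sides at `s` are controlled by the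
opposite side. -/
lemma exists_dist_le_mul_dist_of_le_angle {δ : ℝ} (h0 : 0 < δ) (hπ : δ ≤ π) :
    ∃ C : ℝ, 0 ≤ C ∧ ∀ {d : ℕ} (a s b : Epc d), δ ≤ ∠ a s b → dist s a ≤ C * dist a b := by
  set c := max (cos δ) 0 with hc
  have hc0 : 0 ≤ c := le_max_right _ _
  have hc1 : c < 1 := by
    refine max_lt ?_ one_pos
    simpa using Real.cos_lt_cos_of_nonneg_of_le_pi le_rfl hπ h0
  have hκ : 0 < 1 - c ^ 2 := by nlinarith
  refine ⟨√(1 / (1 - c ^ 2)), Real.sqrt_nonneg _, fun {d} a s b h => ?_⟩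
  have hcos : cos (∠ a s b) ≤ c :=
    (Real.cos_le_cos_of_nonneg_of_le_pi h0.le (angle_le_pi _ _ _) h).trans (le_max_left _ _)
  have hlaw := EuclideanGeometry.law_cos a s b
  have hx : 0 ≤ dist a s := dist_nonneg
  have hy : 0 ≤ dist b s := dist_nonneg
  have hxy := mul_nonneg hx hy
  have hsq : (1 - c ^ 2) * dist a s ^ 2 ≤ dist a b ^ 2 := by
    have := mul_le_mul_of_nonneg_left hcos hxy
    nlinarith [sq_nonneg (dist b s - c * dist a s)]
  rw [dist_comm s a]
  refine abs_le_of_sq_le_sq' ?_ (by positivity) |>.2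
  rw [mul_pow, Real.sq_sqrt (by positivity), one_div, ← div_eq_inv_mul, le_div_iff₀ hκ]
  linarith

lemma exists_orthonormal_pair {d : ℕ} (hd : 2 ≤ d) (x : Epc d) :
    ∃ u w : Epc d, ‖u‖ = 1 ∧ ‖w‖ = 1 ∧ inner ℝ u w = 0 ∧ x = ‖x‖ • u := by
  have hfin : Module.finrank ℝ (Epc d) = d := by simp
  have : Nontrivial (Epc d) := Module.nontrivial_of_finrank_pos (R := ℝ) (by omega)
  obtain ⟨u, hu, hxu⟩ : ∃ u : Epc d, ‖u‖ = 1 ∧ x = ‖x‖ • u := by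
    by_cases hx : x = 0
    · obtain ⟨u, hu⟩ := exists_norm_eq (Epc d) zero_le_one
      exact ⟨u, hu, by simp [hx]⟩
    · have : ‖x‖ ≠ 0 := norm_ne_zero_iff.2 hx
      exact ⟨‖x‖⁻¹ • x, norm_smul_inv_norm hx, by rw [smul_smul, mul_inv_cancel₀ this, one_smul]⟩
  have hu0 : u ≠ 0 := by rintro rfl; simp at hu
  have : Fact (Module.finrank ℝ (Epc d) = (d - 1) + 1) := ⟨by omega⟩
  have hrank := Submodule.finrank_orthogonal_span_singleton (𝕜 := ℝ) (n := d - 1) hu0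
  have : Nontrivial (ℝ ∙ u)ᗮ := Module.nontrivial_of_finrank_pos (R := ℝ) (by omega)
  obtain ⟨w, hw⟩ := exists_norm_eq (ℝ ∙ u)ᗮ zero_le_one
  exact ⟨u, w, hu, hw, Submodule.mem_orthogonal_singleton_iff_inner_right.1 w.2, hxu⟩

lemma angle_eq_of_inner_eq {d : ℕ} {x y : Epc d} (hx : x ≠ 0) (hy : y ≠ 0)
    (h : inner ℝ x y = -(1 / 2) * (‖x‖ * ‖y‖)) : InnerProductGeometry.angle x y = 2 * π / 3 := by
  have hcos : InnerProductGeometry.angle x y = arccos (cos (2 * π / 3)) := by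
    have h0 : ‖x‖ * ‖y‖ ≠ 0 := mul_ne_zero (norm_ne_zero_iff.2 hx) (norm_ne_zero_iff.2 hy)
    rw [InnerProductGeometry.angle, h, mul_div_cancel_right₀ _ h0,
      show 2 * π / 3 = π - π / 3 by ring, Real.cos_pi_sub, Real.cos_pi_div_three]
  rw [hcos, Real.arccos_cos] <;> linarith [Real.pi_pos]

/-- A segment from `q` to `p` can be continued beyond `p` by two segments of length `η` such that
the three segments pairwise make angles `2π/3` at `p`. -/
lemma exists_fork {d : ℕ} (hd : 2 ≤ d) (p q : Epc d) {η : ℝ} (hη : 0 < η) :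
    ∃ a b : Epc d, a ≠ b ∧ dist a p = η ∧ dist b p = η ∧ ∠ a p b = 2 * π / 3 ∧
      (q ≠ p → ∠ q p a = 2 * π / 3 ∧ ∠ q p b = 2 * π / 3) := by
  obtain ⟨u, w, hu, hw, huw, hx⟩ := exists_orthonormal_pair hd (q - p)
  have h3 : √3 * √3 = 3 := Real.mul_self_sqrt (by norm_num)
  have huu : inner ℝ u u = (1 : ℝ) := by rw [real_inner_self_eq_norm_sq, hu, one_pow]
  have hww : inner ℝ w w = (1 : ℝ) := by rw [real_inner_self_eq_norm_sq, hw, one_pow]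
  have hwu : inner ℝ w u = (0 : ℝ) := by rw [real_inner_comm, huw]
  have key : ∀ σ τ : ℝ, inner ℝ (-(1 / 2 : ℝ) • u + σ • w) (-(1 / 2 : ℝ) • u + τ • w) =
      1 / 4 + σ * τ := by
    intro σ τ
    simp only [inner_add_left, inner_add_right, real_inner_smul_left, real_inner_smul_right,
      huu, hww, huw, hwu]
    ring
  have key2 : ∀ σ : ℝ, inner ℝ u (-(1 / 2 : ℝ) • u + σ • w) = -(1 / 2) := by
    intro σ
    simp only [inner_add_right, real_inner_smul_right, huu, huw]
    ring
  have hn : ∀ σ : ℝ, σ * σ = 3 / 4 → ‖-(1 / 2 : ℝ) • u + σ • w‖ = 1 := by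
    intro σ hσ
    have := key σ σ
    rw [real_inner_self_eq_norm_sq, hσ] at this
    exact (sq_eq_sq₀ (norm_nonneg _) zero_le_one).1 (by linarith)
  set f : ℝ → Epc d := fun σ => -(1 / 2 : ℝ) • u + σ • w with hf
  have hs1 : (√3 / 2) * (√3 / 2) = 3 / 4 := by linarith
  have hs2 : (-(√3 / 2)) * (-(√3 / 2)) = 3 / 4 := by linarith
  have hn1 : ‖f (√3 / 2)‖ = 1 := hn _ hs1
  have hn2 : ‖f (-(√3 / 2))‖ = 1 := hn _ hs2
  have ne1 : f (√3 / 2) ≠ 0 := by intro h; simp [h] at hn1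
  have ne2 : f (-(√3 / 2)) ≠ 0 := by intro h; simp [h] at hn2
  have hu0 : u ≠ 0 := by rintro rfl; simp at hu
  have hang : InnerProductGeometry.angle (f (√3 / 2)) (f (-(√3 / 2))) = 2 * π / 3 := by
    refine angle_eq_of_inner_eq ne1 ne2 ?_
    rw [hn1, hn2, hf, key]; linarith
  refine ⟨p + η • f (√3 / 2), p + η • f (-(√3 / 2)), ?_, ?_, ?_, ?_, ?_⟩
  · intro h
    have h := smul_right_injective _ hη.ne' (add_left_cancel h)
    rw [h, InnerProductGeometry.angle_self ne2] at hang
    linarith [Real.pi_pos]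
  · simp [dist_eq_norm, norm_smul, hn1, abs_of_pos hη]
  · simp [dist_eq_norm, norm_smul, hn2, abs_of_pos hη]
  · simp only [EuclideanGeometry.angle, vsub_eq_sub, add_sub_cancel_left]
    rw [InnerProductGeometry.angle_smul_left_of_pos _ _ hη,
      InnerProductGeometry.angle_smul_right_of_pos _ _ hη, hang]
  · intro hq
    have hpos : 0 < ‖q - p‖ := norm_pos_iff.2 (sub_ne_zero.2 hq)
    simp only [EuclideanGeometry.angle, vsub_eq_sub, add_sub_cancel_left]
    rw [hx, InnerProductGeometry.angle_smul_right_of_pos _ _ hη,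
      InnerProductGeometry.angle_smul_right_of_pos _ _ hη,
      InnerProductGeometry.angle_smul_left_of_pos _ _ hpos,
      InnerProductGeometry.angle_smul_left_of_pos _ _ hpos]
    constructor
    · exact angle_eq_of_inner_eq hu0 ne1 (by rw [hn1, hu, hf, key2]; ring)
    · exact angle_eq_of_inner_eq hu0 ne2 (by rw [hn2, hu, hf, key2]; ring)

end Angle

/-! ### Bounding a tree by its shortest competitor -/

section Bound

variable {n d : ℕ}

lemma treeLength_eq_graphLength (G : FullSteinerTopology n) (pos : SteinerVert n → Epc d) :
    treeLength G pos = graphLength G.graph pos := rfl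

lemma minTreeLength_le (G : FullSteinerTopology n) {pos pos' : SteinerVert n → Epc d}
    (h : ∀ t : Fin n, pos' (Sum.inl t) = pos (Sum.inl t)) :
    minTreeLength G pos ≤ treeLength G pos' :=
  csInf_le ⟨0, by rintro _ ⟨p, -, rfl⟩; exact graphLength_nonneg _ _⟩ ⟨pos', h, rfl⟩

lemma le_minTreeLength (G : FullSteinerTopology n) {pos : SteinerVert n → Epc d} {c : ℝ}
    (h : ∀ pos' : SteinerVert n → Epc d,
      (∀ t : Fin n, pos' (Sum.inl t) = pos (Sum.inl t)) → c ≤ treeLength G pos') :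
    c ≤ minTreeLength G pos :=
  le_csInf ⟨_, pos, fun _ => rfl, rfl⟩ (by rintro _ ⟨p, hp, rfl⟩; exact h p hp)

lemma minTreeLength_nonneg (G : FullSteinerTopology n) (pos : SteinerVert n → Epc d) :
    0 ≤ minTreeLength G pos :=
  le_minTreeLength G fun _ _ => graphLength_nonneg _ _

lemma dist_terminal_le (G : FullSteinerTopology n) (pos : SteinerVert n → Epc d) (s t : Fin n) :
    dist (pos (Sum.inl s)) (pos (Sum.inl t)) ≤
      2 * Fintype.card (SteinerVert n) * minTreeLength G pos := by
  have hc : (0 : ℝ) < 2 * Fintype.card (SteinerVert n) := by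
    have : 0 < Fintype.card (SteinerVert n) := Fintype.card_pos_iff.2 ⟨Sum.inl s⟩
    positivity
  rw [mul_comm, ← div_le_iff₀ hc]
  refine le_minTreeLength G fun pos' h => ?_
  rw [div_le_iff₀ hc, mul_comm, ← h s, ← h t]
  exact dist_le_card_mul_graphLength G.isTree.connected _ _ _

lemma minTreeLength_pos (G : FullSteinerTopology n) (pos : SteinerVert n → Epc d) {s t : Fin n}
    (h : pos (Sum.inl s) ≠ pos (Sum.inl t)) : 0 < minTreeLength G pos := by
  refine (minTreeLength_nonneg G pos).lt_of_ne fun h0 => ?_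
  have := dist_terminal_le G pos s t
  rw [← h0, mul_zero] at this
  exact (dist_pos.2 h).not_ge this

lemma IsApproxSteiner.dist_le {ε C D : ℝ} {G : FullSteinerTopology n}
    {pos : SteinerVert n → Epc d} (hpos : IsApproxSteiner ε G pos) (r : SteinerVert n)
    (hC : 0 ≤ C) (hD : 0 ≤ D)
    (hang : ∀ a s b : Epc d,
      2 * π / 3 - ε ≤ EuclideanGeometry.angle a s b → dist s a ≤ C * dist a b)
    (hr : ∀ t : Fin n, dist (pos (Sum.inl t)) (pos r) ≤ D) (j : ℕ) (v : SteinerVert n)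
    (hj : Fintype.card (SteinerVert n) ≤ G.graph.dist r v + j) :
    dist (pos v) (pos r) ≤ (2 * C + 1) ^ j * D := by
  induction j generalizing v with
  | zero =>
    obtain ⟨p, hp⟩ := G.isTree.connected.exists_walk_length_eq_dist r v
    have := (p.isPath_of_length_eq_dist hp).length_lt
    omega
  | succ j ih =>
    rcases v with t | s
    · refine (hr t).trans (le_mul_of_one_le_left hD (one_le_pow₀ (by linarith)))
    · obtain ⟨a, b, hab, ha, hb, hda, hdb⟩ :=
        exists_two_farther_neighbors G.isTree r _ (G.degSteiner s)
      have h1 := ih a (by omega)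
      have h2 := ih b (by omega)
      have h3 := hang (pos a) (pos (Sum.inr s)) (pos b)
        (by linarith [(abs_le.1 (hpos s a b ha hb hab)).1])
      have h4 : dist (pos a) (pos b) ≤ 2 * ((2 * C + 1) ^ j * D) := by
        linarith [dist_triangle_right (pos a) (pos b) (pos r)]
      have h5 := mul_le_mul_of_nonneg_left h4 hC
      have h6 := dist_triangle (pos (Sum.inr s)) (pos a) (pos r)
      rw [pow_succ]
      linarith

lemma exists_treeLength_le (n : ℕ) (hn : 0 < n) {ε : ℝ} (hε : 0 < ε) (hε' : ε < 2 * π / 3) :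
    ∃ K : ℝ, 0 ≤ K ∧ ∀ {d : ℕ} (G : FullSteinerTopology n) (pos : SteinerVert n → Epc d),
      IsApproxSteiner ε G pos → treeLength G pos ≤ K * minTreeLength G pos := by
  obtain ⟨C, hC, hang⟩ := exists_dist_le_mul_dist_of_le_angle (δ := 2 * π / 3 - ε)
    (by linarith) (by linarith [Real.pi_pos])
  set N := Fintype.card (SteinerVert n) with hN
  refine ⟨(N : ℝ) ^ 2 * (2 * ((2 * C + 1) ^ N * (2 * N))), by positivity, fun {d} G pos h => ?_⟩
  have hm := minTreeLength_nonneg G pos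
  have key := fun v => h.dist_le (Sum.inl ⟨0, hn⟩) hC (by positivity) hang
    (fun t => dist_terminal_le G pos t ⟨0, hn⟩) N v (by omega)
  have := graphLength_le_of_dist_le G.graph pos
    (D := 2 * ((2 * C + 1) ^ N * (2 * N * minTreeLength G pos))) (by positivity) (fun u v => by
      linarith [key u, key v, dist_triangle_right (pos u) (pos v) (pos (Sum.inl ⟨0, hn⟩))])
  rw [treeLength_eq_graphLength]
  refine this.trans (le_of_eq ?_)
  ring

end Bound

/-! ### Splitting a terminal into a Steiner point and two terminals -/

section Extension

variable {n d : ℕ}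

/-- The vertices that are terminals after the terminal `t` has been turned into a Steiner point
with two new terminals attached to it. -/
def IsSplitTerminal (t : Fin n) : Option (Option (SteinerVert n)) → Prop
  | none => True
  | some none => True
  | some (some (Sum.inl i)) => i ≠ t
  | some (some (Sum.inr _)) => False

lemma exists_splitEquiv (hn : 2 ≤ n) (t : Fin n) :
    ∃ e : Option (Option (SteinerVert n)) ≃ SteinerVert (n + 1),
      (∀ i, IsSplitTerminal t (e.symm (Sum.inl i))) ∧
      (∀ s, ¬ IsSplitTerminal t (e.symm (Sum.inr s))) := by
  classical
  have h1 : Fintype.card {w // IsSplitTerminal t w} = n + 1 := by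
    rw [Fintype.card_subtype, Finset.card_filter, Fintype.sum_option, Fintype.sum_option,
      Fintype.sum_sum_type]
    have hl : ∀ i : Fin n, (if IsSplitTerminal t (some (some (Sum.inl i))) then 1 else 0) =
        if i ∈ ({t} : Finset (Fin n))ᶜ then 1 else 0 := fun i => by
      refine if_congr ?_ rfl rfl
      simp [IsSplitTerminal]
    have hr : ∀ s : Fin (n - 2),
        (if IsSplitTerminal t (some (some (Sum.inr s))) then 1 else 0) = 0 := fun s => if_neg id
    rw [if_pos (show IsSplitTerminal t none from trivial),
      if_pos (show IsSplitTerminal t (some none) from trivial)]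
    simp only [hl, hr, Finset.sum_const_zero, Finset.sum_ite_mem, Finset.univ_inter,
      Finset.sum_const, Finset.card_compl, Finset.card_singleton, Fintype.card_fin, smul_eq_mul]
    omega
  have h2 : Fintype.card {w // ¬ IsSplitTerminal t w} = n + 1 - 2 := by
    rw [Fintype.card_subtype_compl, h1]
    simp
    omega
  let e := (Equiv.sumCompl (IsSplitTerminal t)).symm.trans
    (Equiv.sumCongr (Fintype.equivFinOfCardEq h1) (Fintype.equivFinOfCardEq h2))
  refine ⟨e, fun i => ?_, fun s => ?_⟩
  · simpa [e] using ((Fintype.equivFinOfCardEq h1).symm i).2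
  · simpa [e] using ((Fintype.equivFinOfCardEq h2).symm s).2

/-- The graph obtained from a full Steiner topology by attaching two leaves to the terminal `t`. -/
def splitGraph (G : FullSteinerTopology n) (t : Fin n) :
    SimpleGraph (Option (Option (SteinerVert n))) :=
  attachLeaf (attachLeaf G.graph (Sum.inl t)) (some (Sum.inl t))

lemma splitGraph_ncard_of_terminal (G : FullSteinerTopology n) (t : Fin n)
    {w : Option (Option (SteinerVert n))} (hw : IsSplitTerminal t w) :
    ((splitGraph G t).neighborSet w).ncard = 1 := by
  unfold splitGraph
  rcases w with _ | _ | i | s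
  · rw [attachLeaf_neighborSet_none, Set.ncard_singleton]
  · rw [attachLeaf_ncard_of_ne _ (by simp), attachLeaf_neighborSet_none, Set.ncard_singleton]
  · have hw : i ≠ t := hw
    rw [attachLeaf_ncard_of_ne _ (by simpa using hw), attachLeaf_ncard_of_ne _ (by simpa using hw),
      G.degTerminal]
  · exact hw.elim

lemma splitGraph_ncard_of_not_terminal (G : FullSteinerTopology n) (t : Fin n)
    {w : Option (Option (SteinerVert n))} (hw : ¬ IsSplitTerminal t w) :
    ((splitGraph G t).neighborSet w).ncard = 3 := by
  unfold splitGraph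
  rcases w with _ | _ | i | s
  · exact (hw trivial).elim
  · exact (hw trivial).elim
  · obtain rfl : i = t := not_not.1 hw
    rw [attachLeaf_ncard_self, attachLeaf_ncard_self, G.degTerminal]
  · rw [attachLeaf_ncard_of_ne _ (by simp), attachLeaf_ncard_of_ne _ (by simp), G.degSteiner]

lemma ncard_neighborSet_comap {V W : Type*} (H : SimpleGraph W) (e : V ≃ W) (v : V) :
    ((H.comap e).neighborSet v).ncard = (H.neighborSet (e v)).ncard := by
  have : (H.comap e).neighborSet v = e ⁻¹' (H.neighborSet (e v)) := by
    ext x; simp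
  rw [this, Set.ncard_preimage_of_injective_subset_range e.injective (by simp)]

/-- The full Steiner topology on `n + 1` terminals obtained by attaching two leaves to the
terminal `t`, with vertices relabelled along `e`. -/
def splitTopology (G : FullSteinerTopology n) (t : Fin n)
    (e : Option (Option (SteinerVert n)) ≃ SteinerVert (n + 1))
    (h1 : ∀ i, IsSplitTerminal t (e.symm (Sum.inl i)))
    (h2 : ∀ s, ¬ IsSplitTerminal t (e.symm (Sum.inr s))) : FullSteinerTopology (n + 1) where
  graph := (splitGraph G t).comap e.symm
  isTree := (SimpleGraph.Iso.isTree_iff (SimpleGraph.Iso.comap e.symm _)).2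
    (attachLeaf_isTree (attachLeaf_isTree G.isTree _) _)
  degTerminal i := by
    rw [ncard_neighborSet_comap, splitGraph_ncard_of_terminal G t (h1 i)]
  degSteiner s := by
    rw [ncard_neighborSet_comap, splitGraph_ncard_of_not_terminal G t (h2 s)]

/-- Extend a realization by placing the two new terminals at `a` and `b`. -/
def splitPos (pos : SteinerVert n → Epc d) (a b : Epc d) :
    Option (Option (SteinerVert n)) → Epc d
  | none => b
  | some none => a
  | some (some v) => pos v

lemma graphLength_splitPos (G : FullSteinerTopology n) (t : Fin n) (pos : SteinerVert n → Epc d)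
    (a b : Epc d) : graphLength (splitGraph G t) (splitPos pos a b) =
      treeLength G pos + dist a (pos (Sum.inl t)) + dist b (pos (Sum.inl t)) := by
  rw [splitGraph, graphLength_attachLeaf, graphLength_attachLeaf]
  rfl

lemma splitPos_angle {ε : ℝ} (hε : 0 ≤ ε) {G : FullSteinerTopology n}
    {pos : SteinerVert n → Epc d}
    (hpos : IsApproxSteiner ε G pos) {t : Fin n} {q : SteinerVert n}
    (hq : G.graph.neighborSet (Sum.inl t) = {q}) {a b : Epc d}
    (hab : EuclideanGeometry.angle a (pos (Sum.inl t)) b = 2 * π / 3)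
    (hqa : |EuclideanGeometry.angle (pos q) (pos (Sum.inl t)) a - 2 * π / 3| ≤ ε)
    (hqb : |EuclideanGeometry.angle (pos q) (pos (Sum.inl t)) b - 2 * π / 3| ≤ ε)
    {w u v : Option (Option (SteinerVert n))} (hw : ¬ IsSplitTerminal t w)
    (hu : (splitGraph G t).Adj w u) (hv : (splitGraph G t).Adj w v) (huv : u ≠ v) :
    |EuclideanGeometry.angle (splitPos pos a b u) (splitPos pos a b w) (splitPos pos a b v)
      - 2 * π / 3| ≤ ε := by
  unfold splitGraph at hu hv
  have hq' : ∀ x, G.graph.Adj (Sum.inl t) x ↔ x = q := fun x => by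
    rw [← SimpleGraph.mem_neighborSet, hq, Set.mem_singleton_iff]
  rcases w with _ | _ | i | s
  · exact (hw trivial).elim
  · exact (hw trivial).elim
  · obtain rfl : i = t := not_not.1 hw
    have hab' : |EuclideanGeometry.angle a (pos (Sum.inl i)) b - 2 * π / 3| ≤ ε := by
      simpa [hab] using hε
    rcases u with _ | _ | u <;> rcases v with _ | _ | v
    · exact (huv rfl).elim
    · rw [EuclideanGeometry.angle_comm]; exact hab'
    · obtain rfl : v = q := by simpa [hq'] using hv
      rw [EuclideanGeometry.angle_comm]; exact hqb
    · exact hab'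
    · exact (huv rfl).elim
    · obtain rfl : v = q := by simpa [hq'] using hv
      rw [EuclideanGeometry.angle_comm]; exact hqa
    · obtain rfl : u = q := by simpa [hq'] using hu
      exact hqb
    · obtain rfl : u = q := by simpa [hq'] using hu
      exact hqa
    · obtain rfl : u = q := by simpa [hq'] using hu
      obtain rfl : v = u := by simpa [hq'] using hv
      exact (huv rfl).elim
  · rcases u with _ | _ | u
    · simp at hu
    · simp at hu
    rcases v with _ | _ | v
    · simp at hv
    · simp at hv
    exact hpos s u v (by simpa using hu) (by simpa using hv) (by simpa using huv)

/-- A terminal whose edge is non-degenerate, or for which a right angle is an admissible angle,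
can be replaced by two terminals at distance `η`. -/
lemma exists_extension (hd : 2 ≤ d) (hn : 2 ≤ n) {ε η : ℝ} (hε : 0 ≤ ε) (hη : 0 < η)
    (G : FullSteinerTopology n) (pos : SteinerVert n → Epc d) (hpos : IsApproxSteiner ε G pos)
    (t : Fin n)
    (ht : ∀ q, G.graph.Adj (Sum.inl t) q → pos q ≠ pos (Sum.inl t) ∨ π / 6 ≤ ε) :
    ∃ (G' : FullSteinerTopology (n + 1)) (pos' : SteinerVert (n + 1) → Epc d),
      IsApproxSteiner ε G' pos' ∧ treeLength G' pos' = treeLength G pos + 2 * η ∧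
      minTreeLength G' pos' ≤ minTreeLength G pos + 2 * η ∧ 0 < minTreeLength G' pos' ∧
      ∃ t', ∀ q, G'.graph.Adj (Sum.inl t') q → pos' q ≠ pos' (Sum.inl t') := by
  obtain ⟨e, h1, h2⟩ := exists_splitEquiv hn t
  obtain ⟨q, hq⟩ := Set.ncard_eq_one.1 (G.degTerminal t)
  obtain ⟨a, b, hne, ha, hb, hab, hang⟩ := exists_fork hd (pos (Sum.inl t)) (pos q) hη
  have hterm : ∀ w, IsSplitTerminal t w → ∃ i, e w = Sum.inl i := by
    intro w hw
    rcases hew : e w with i | s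
    · exact ⟨i, rfl⟩
    · exact (h2 s (by rwa [← hew, e.symm_apply_apply])).elim
  obtain ⟨i₀, hi₀⟩ := hterm none trivial
  obtain ⟨i₁, hi₁⟩ := hterm (some none) trivial
  have hi₀' : e.symm (Sum.inl i₀) = none := by rw [← hi₀, e.symm_apply_apply]
  have hi₁' : e.symm (Sum.inl i₁) = some none := by rw [← hi₁, e.symm_apply_apply]
  have hlen : ∀ p : SteinerVert n → Epc d, p (Sum.inl t) = pos (Sum.inl t) →
      treeLength (splitTopology G t e h1 h2) (fun v => splitPos p a b (e.symm v)) =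
        treeLength G p + 2 * η := by
    intro p hp
    rw [treeLength_eq_graphLength, splitTopology, graphLength_comap]
    simp only [Equiv.symm_symm, Equiv.symm_apply_apply]
    rw [graphLength_splitPos, hp, ha, hb]
    ring
  have hright : ∀ c : Epc d, (pos q ≠ pos (Sum.inl t) →
      EuclideanGeometry.angle (pos q) (pos (Sum.inl t)) c = 2 * π / 3) →
      |EuclideanGeometry.angle (pos q) (pos (Sum.inl t)) c - 2 * π / 3| ≤ ε := by
    intro c hc
    by_cases hqt : pos q = pos (Sum.inl t)
    · have h6 := (ht q (by rw [← SimpleGraph.mem_neighborSet, hq]; rfl)).resolve_left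
        (not_not.2 hqt)
      rw [hqt, EuclideanGeometry.angle_self_left, abs_le]
      constructor <;> linarith [Real.pi_pos]
    · rw [hc hqt, sub_self, abs_zero]; exact hε
  refine ⟨splitTopology G t e h1 h2, fun v => splitPos pos a b (e.symm v), ?_, hlen pos rfl,
    ?_, ?_, i₀, ?_⟩
  · intro s u v hu hv huv
    exact splitPos_angle hε hpos hq hab (hright a fun h => (hang h).1)
      (hright b fun h => (hang h).2) (h2 s) hu hv (e.symm.injective.ne huv)
  · rw [← sub_le_iff_le_add]
    refine le_minTreeLength G fun p hp => ?_
    rw [sub_le_iff_le_add, ← hlen p (hp t)]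
    refine minTreeLength_le _ fun i => ?_
    have := h1 i
    rcases hw : e.symm (Sum.inl i) with _ | _ | j | s
    · rfl
    · rfl
    · exact hp j
    · rw [hw] at this; exact False.elim this
  · refine minTreeLength_pos _ _ (s := i₀) (t := i₁) ?_
    simp only [hi₀', hi₁']
    exact hne.symm
  · intro x hx
    have hx : (splitGraph G t).Adj (e.symm (Sum.inl i₀)) (e.symm x) := hx
    simp only [hi₀'] at hx ⊢
    rcases hex : e.symm x with _ | y
    · simp [hex, splitGraph] at hx
    · obtain rfl : y = some (Sum.inl t) := by simpa [hex, splitGraph] using hx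
      change pos (Sum.inl t) ≠ b
      rintro h
      rw [h, dist_self] at hb
      exact hη.ne hb

lemma exists_isApproxSteiner_two (hd : 2 ≤ d) (ε : ℝ) :
    ∃ (G : FullSteinerTopology 2) (pos : SteinerVert 2 → Epc d), IsApproxSteiner ε G pos ∧
      ∃ t, ∀ q, G.graph.Adj (Sum.inl t) q → pos q ≠ pos (Sum.inl t) := by
  have : Nontrivial (Epc d) := Module.nontrivial_of_finrank_pos (R := ℝ)
    (by rw [finrank_euclideanSpace_fin]; omega)
  obtain ⟨x, hx⟩ := exists_ne (0 : Epc d)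
  have hcard : Fintype.card (SteinerVert 2) = 2 := rfl
  refine ⟨⟨⊤, ⟨SimpleGraph.connected_top, .of_card_le_two ?_⟩, fun t => ?_, fun s => s.elim0⟩,
    fun v => if v = Sum.inl 0 then 0 else x, fun s => s.elim0, 0, fun q hq => ?_⟩
  · rw [ENat.card_eq_coe_fintype_card, hcard]; rfl
  · rw [SimpleGraph.neighborSet_top, Set.ncard_compl, Set.ncard_singleton,
      Nat.card_eq_fintype_card, hcard]
  · have hq : Sum.inl 0 ≠ q := hq
    simp [hq.symm, hx]

lemma exists_isApproxSteiner (hd : 2 ≤ d) {ε : ℝ} (hε : 0 ≤ ε) (hn : 2 ≤ n) :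
    ∃ (G : FullSteinerTopology n) (pos : SteinerVert n → Epc d), IsApproxSteiner ε G pos ∧
      ∃ t, ∀ q, G.graph.Adj (Sum.inl t) q → pos q ≠ pos (Sum.inl t) := by
  induction n, hn using Nat.le_induction with
  | base => exact exists_isApproxSteiner_two hd ε
  | succ n hn ih =>
    obtain ⟨G, pos, h, t, ht⟩ := ih
    obtain ⟨G', pos', h', -, -, -, ht'⟩ :=
      exists_extension hd hn hε one_pos G pos h t fun q hq => Or.inl (ht q hq)
    exact ⟨G', pos', h', ht'⟩

lemma not_adj_terminal_terminal (hn : 3 ≤ n) (G : FullSteinerTopology n) (i j : Fin n) :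
    ¬ G.graph.Adj (Sum.inl i) (Sum.inl j) := by
  intro h
  have hi : ∀ x, G.graph.Adj (Sum.inl i) x → x = Sum.inl j := by
    obtain ⟨q, hq⟩ := Set.ncard_eq_one.1 (G.degTerminal i)
    have hm : ∀ x, G.graph.Adj (Sum.inl i) x ↔ x = q := fun x => by
      rw [← SimpleGraph.mem_neighborSet, hq, Set.mem_singleton_iff]
    intro x hx
    rw [(hm x).1 hx, (hm _).1 h]
  have hj : ∀ x, G.graph.Adj (Sum.inl j) x → x = Sum.inl i := by
    obtain ⟨q, hq⟩ := Set.ncard_eq_one.1 (G.degTerminal j)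
    have hm : ∀ x, G.graph.Adj (Sum.inl j) x ↔ x = q := fun x => by
      rw [← SimpleGraph.mem_neighborSet, hq, Set.mem_singleton_iff]
    intro x hx
    rw [(hm x).1 hx, (hm _).1 h.symm]
  have key : ∀ u v (_ : G.graph.Walk u v), (u = Sum.inl i ∨ u = Sum.inl j) →
      (v = Sum.inl i ∨ v = Sum.inl j) := by
    intro u v w
    induction w with
    | nil => exact id
    | cons hadj w ih =>
      rintro (rfl | rfl)
      · exact ih (Or.inr (hi _ hadj))
      · exact ih (Or.inl (hj _ hadj))
  obtain ⟨w⟩ := G.isTree.connected.preconnected (Sum.inl i) (Sum.inr ⟨0, by omega⟩)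
  simpa using key _ _ w (Or.inl rfl)

lemma IsApproxSteiner.ne_or_le {ε : ℝ} (hn : 3 ≤ n) {G : FullSteinerTopology n}
    {pos : SteinerVert n → Epc d} (hpos : IsApproxSteiner ε G pos) {t : Fin n}
    {q : SteinerVert n} (hq : G.graph.Adj (Sum.inl t) q) :
    pos q ≠ pos (Sum.inl t) ∨ π / 6 ≤ ε := by
  rcases q with j | s
  · exact (not_adj_terminal_terminal hn G t j hq).elim
  refine or_iff_not_imp_left.2 fun h => ?_
  obtain ⟨v, hv, hvt⟩ := Set.exists_ne_of_one_lt_ncard (s := G.graph.neighborSet (Sum.inr s))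
    (by rw [G.degSteiner]; norm_num) (Sum.inl t)
  have := hpos s _ v hq.symm hv hvt.symm
  rw [not_not.1 h, EuclideanGeometry.angle_self_left] at this
  linarith [(abs_le.1 this).1]

end Extension

/-! ### Monotonicity -/

section Monotone

variable {n d : ℕ}

/-- If `ε ≥ 2π/3` every realization is admissible, and the ratios are unbounded. -/
lemma steinerF_eq_zero (hd : 2 ≤ d) {ε : ℝ} (hε : 2 * π / 3 ≤ ε) (hn : 3 ≤ n) :
    steinerF d ε n = 0 := by
  have : Nontrivial (Epc d) := Module.nontrivial_of_finrank_pos (R := ℝ)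
    (by rw [finrank_euclideanSpace_fin]; omega)
  obtain ⟨x, hx⟩ := exists_norm_eq (Epc d) zero_le_one
  obtain ⟨G, -, -, -⟩ := exists_isApproxSteiner (n := n) hd (ε := 0) le_rfl (by omega)
  refine Real.sSup_of_not_bddAbove ?_
  rintro ⟨B, hB⟩
  let i₀ : Fin n := ⟨0, by omega⟩
  let i₁ : Fin n := ⟨1, by omega⟩
  let pos : ℝ → SteinerVert n → Epc d := fun R =>
    Sum.elim (fun i => if i = i₀ then 0 else x) (fun _ => R • x)
  have happrox : ∀ R, IsApproxSteiner ε G (pos R) := by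
    intro R s u v _ _ _
    have h0 := EuclideanGeometry.angle_nonneg (pos R u) (pos R (Sum.inr s)) (pos R v)
    have h1 := EuclideanGeometry.angle_le_pi (pos R u) (pos R (Sum.inr s)) (pos R v)
    rw [abs_le]
    constructor <;> linarith [Real.pi_pos]
  have hmin : ∀ R, 0 < minTreeLength G (pos R) := by
    intro R
    refine minTreeLength_pos G _ (s := i₀) (t := i₁) ?_
    have h01 : i₁ ≠ i₀ := by simp [i₀, i₁]
    have : x ≠ 0 := by rintro rfl; simp at hx
    simpa [pos, h01] using this.symm
  have hM : ∀ R, minTreeLength G (pos R) ≤ treeLength G (pos 0) :=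
    fun R => minTreeLength_le G fun t => rfl
  set M := treeLength G (pos 0) with hMdef
  have hM0 : 0 < M := (hmin 0).trans_le (hM 0)
  set N := Fintype.card (SteinerVert n) with hN
  have hlen : ∀ R, 0 ≤ R → R ≤ 2 * N * treeLength G (pos R) := by
    intro R hR
    have hdist : dist (pos R (Sum.inr ⟨0, by omega⟩)) (pos R (Sum.inl i₀)) = R := by
      simp [pos, norm_smul, hx, abs_of_nonneg hR]
    exact hdist.symm.trans_le (dist_le_card_mul_graphLength G.isTree.connected (pos R) _ _)
  have hub : ∀ R, treeLength G (pos R) ≤ (|B| + 1) * M := by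
    intro R
    have h1 := hB ⟨G, pos R, happrox R, rfl⟩
    have h2 : treeLength G (pos R) / minTreeLength G (pos R) ≤ |B| + 1 := by
      linarith [le_abs_self B]
    rw [div_le_iff₀ (hmin R)] at h2
    exact h2.trans (mul_le_mul_of_nonneg_left (hM R) (by positivity))
  have hbig := hlen (2 * N * ((|B| + 1) * M) + 1) (by positivity)
  have := mul_le_mul_of_nonneg_left (hub (2 * N * ((|B| + 1) * M) + 1))
    (show (0 : ℝ) ≤ 2 * N by positivity)
  linarith

lemma bddAbove_ratios (d : ℕ) {ε : ℝ} (hε : 0 < ε) (hε' : ε < 2 * π / 3) (hn : 0 < n) :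
    BddAbove { r : ℝ | ∃ (G : FullSteinerTopology n) (pos : SteinerVert n → Epc d),
      IsApproxSteiner ε G pos ∧ r = treeLength G pos / minTreeLength G pos - 1 } := by
  obtain ⟨K, hK, h⟩ := exists_treeLength_le n hn hε hε'
  refine ⟨K, ?_⟩
  rintro _ ⟨G, pos, hpos, rfl⟩
  have := div_le_of_le_mul₀ (minTreeLength_nonneg G pos) hK (h G pos hpos)
  linarith

end Monotone

/-- `F_d(ε, n)` is monotone in `n`: for `d ≥ 2`, `ε > 0` and `n ≥ 3`,
`F_d(ε, n) ≤ F_d(ε, n+1)`. -/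
theorem steinerF_monotone (d : ℕ) (hd : 2 ≤ d) (ε : ℝ) (hε : 0 < ε)
    (n : ℕ) (hn : 3 ≤ n) :
    steinerF d ε n ≤ steinerF d ε (n + 1) := by
  rcases le_or_gt (2 * π / 3) ε with hbig | hsmall
  · rw [steinerF_eq_zero hd hbig hn, steinerF_eq_zero hd hbig (by omega)]
  have hbdd := bddAbove_ratios (n := n + 1) d hε hsmall (by omega)
  obtain ⟨G₀, pos₀, h₀, -⟩ := exists_isApproxSteiner (n := n) hd hε.le (by omega)
  refine csSup_le ⟨_, G₀, pos₀, h₀, rfl⟩ ?_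
  rintro _ ⟨G, pos, hpos, rfl⟩
  have hstep : ∀ η : ℝ, 0 < η → ∃ m' : ℝ, 0 < m' ∧ m' ≤ minTreeLength G pos + 2 * η ∧
      (treeLength G pos + 2 * η) / m' - 1 ≤ steinerF d ε (n + 1) := by
    intro η hη
    obtain ⟨G', pos', h', hlen, hle, hmpos, -⟩ := exists_extension hd (by omega) hε.le hη G pos
      hpos ⟨0, by omega⟩ fun q hq => hpos.ne_or_le hn hq
    exact ⟨_, hmpos, hle, le_csSup hbdd ⟨G', pos', h', by rw [hlen]⟩⟩
  have hL : 0 ≤ treeLength G pos := graphLength_nonneg _ _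
  rcases (minTreeLength_nonneg G pos).eq_or_lt with hm | hm
  · obtain ⟨m', hm', -, h⟩ := hstep 1 one_pos
    rw [← hm, div_zero]
    have : 0 ≤ (treeLength G pos + 2 * 1) / m' := by positivity
    linarith
  · have hlim : Filter.Tendsto
        (fun η : ℝ => (treeLength G pos + 2 * η) / (minTreeLength G pos + 2 * η) - 1)
        (nhdsWithin 0 (Set.Ioi 0)) (nhds (treeLength G pos / minTreeLength G pos - 1)) := by
      have hc : ContinuousAt
          (fun η : ℝ => (treeLength G pos + 2 * η) / (minTreeLength G pos + 2 * η) - 1) 0 := by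
        refine ContinuousAt.sub (ContinuousAt.div (by fun_prop) (by fun_prop) ?_)
          continuousAt_const
        simpa using hm.ne'
      simpa [ContinuousAt] using hc.tendsto.mono_left nhdsWithin_le_nhds
    refine le_of_tendsto hlim ?_
    filter_upwards [self_mem_nhdsWithin] with η hη
    have hη : 0 < η := hη
    obtain ⟨m', hm', hle, h⟩ := hstep η hη
    refine le_trans (sub_le_sub_right ?_ 1) h
    exact div_le_div_of_nonneg_left (by positivity) hm' hle

end
end
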